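/- A C*-algebra A is a weakly Rickart C*-algebra if and only if: for every x ∈ A and every inner ideal J ⊆ A orthogonal to the inner ideal A(x) generated by x, there exists a partial isometry e ∈ A such that A(x) ⊆ A₂(e), e* e is the annihilating right projection RP(x) of x, e e* is the annihilating left projection LP(x) of x, x is a positive element of the C*-algebra (A₂(e), •_e, *_e) (equivalently, e* x is positive in A), A(x) is closed under the product a •_e b = a e* b and the involution a ↦ e a* e, and J ⊆ A₀(e). -/

import Mathlib

/-- A projection in a C*-algebra: a self-adjoint idempotent. -/
def IsProjection {A : Type*} [Mul A] [Star A] (p : A) : Prop :=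
  star p = p ∧ p * p = p

/-- A partial isometry: an element `e` such that `e * e*` is a projection. -/
def IsPartialIsometry {A : Type*} [Mul A] [Star A] (e : A) : Prop :=
  IsProjection (e * star e)

/-- `p` is an annihilating right projection (ARP) of `x`. -/
def IsARP {A : Type*} [Mul A] [Star A] [Zero A] (x p : A) : Prop :=
  IsProjection p ∧ x * p = x ∧ ∀ y : A, x * y = 0 → p * y = 0

/-- `q` is an annihilating left projection (ALP) of `x`. -/
def IsALP {A : Type*} [Mul A] [Star A] [Zero A] (x q : A) : Prop :=
  IsProjection q ∧ q * x = x ∧ ∀ y : A, y * x = 0 → y * q = 0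

/-- A C*-algebra is weakly Rickart if every element admits an ARP. -/
def WeaklyRickart (A : Type*) [NonUnitalCStarAlgebra A] : Prop :=
  ∀ x : A, ∃ p : A, IsARP x p

/-- The Peirce-2 subspace associated with a partial isometry `e`. -/
def Peirce2 {A : Type*} [Mul A] [Star A] (e : A) : Set A :=
  {z : A | e * star e * z * (star e * e) = z}

/-- The Peirce-0 subspace associated with a partial isometry `e`. -/
def Peirce0 {A : Type*} [Mul A] [Star A] [Zero A] (e : A) : Set A :=
  {z : A | e * star e * z = 0 ∧ z * (star e * e) = 0}

/-- Orthogonality of elements in a C*-algebra: `a ⊥ b` iff `a b* = 0` and `b* a = 0`. -/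
def Orthog {A : Type*} [Mul A] [Star A] [Zero A] (a b : A) : Prop :=
  a * star b = 0 ∧ star b * a = 0

/-- A linear subspace `J` is an inner ideal if `x a y ∈ J` for all `x, y ∈ J`, `a ∈ A`. -/
def IsInnerIdeal {A : Type*} [NonUnitalCStarAlgebra A] (J : Submodule ℂ A) : Prop :=
  ∀ x ∈ J, ∀ y ∈ J, ∀ a : A, x * a * y ∈ J

/-- The inner ideal of `A` generated by `x`: the norm closure of `x A x`. -/
def innerIdealGen {A : Type*} [NonUnitalCStarAlgebra A] (x : A) : Set A :=
  closure {z : A | ∃ a : A, z = x * a * x}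

section Annihilators

variable {A : Type*} [NonUnitalCStarAlgebra A]

theorem IsProjection.isStarProjection {p : A} (hp : IsProjection p) : IsStarProjection p :=
  ⟨hp.2, hp.1⟩

theorem IsProjection.norm_le_one {p : A} (hp : IsProjection p) : ‖p‖ ≤ 1 :=
  hp.isStarProjection.norm_le

theorem IsARP.mul_left_of_isSelfAdjoint {h p : A} (hp : IsARP h p) (hh : IsSelfAdjoint h) :
    p * h = h := by
  have := congrArg star hp.2.1
  rwa [star_mul, hp.1.1, hh.star_eq] at this

theorem IsARP.mul_right_eq_zero {h p y : A} (hp : IsARP h p) (hh : IsSelfAdjoint h)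
    (hy : y * h = 0) : y * p = 0 := by
  have h1 := congrArg star hy
  rw [star_mul, hh.star_eq, star_zero] at h1
  have h2 := congrArg star (hp.2.2 _ h1)
  rwa [star_mul, star_star, hp.1.1, star_zero] at h2

theorem IsARP.commute {h p c : A} (hp : IsARP h p) (hh : IsSelfAdjoint h) (hc : Commute c h) :
    Commute c p := by
  have h1 : h * (c - c * p) = 0 := by
    rw [mul_sub, ← mul_assoc, ← hc.eq, mul_assoc, hp.2.1, sub_self]
  have h2 : (c - p * c) * h = 0 := by
    rw [sub_mul, mul_assoc, hc.eq, ← mul_assoc, hp.mul_left_of_isSelfAdjoint hh, sub_self]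
  have h3 := hp.2.2 _ h1
  have h4 := hp.mul_right_eq_zero hh h2
  rw [mul_sub, sub_eq_zero] at h3
  rw [sub_mul, sub_eq_zero] at h4
  exact h4.trans ((mul_assoc _ _ _).trans h3.symm)

theorem IsARP.of_star_mul_self {x p : A} (hp : IsARP x p) : IsARP (star x * x) p := by
  refine ⟨hp.1, by rw [mul_assoc, hp.2.1], fun y hy => hp.2.2 y ?_⟩
  rw [← CStarRing.star_mul_self_eq_zero_iff, star_mul, mul_assoc, ← mul_assoc _ x, hy, mul_zero]

theorem IsARP.star_isALP {x p : A} (hp : IsARP (star x) p) : IsALP x p := by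
  refine ⟨hp.1, ?_, fun y hy => ?_⟩
  · have := congrArg star hp.2.1
    rwa [star_mul, star_star, hp.1.1] at this
  · have h1 := congrArg star hy
    rw [star_mul, star_zero] at h1
    have h2 := congrArg star (hp.2.2 _ h1)
    rwa [star_mul, star_star, hp.1.1, star_zero] at h2

theorem IsALP.star_isARP {x p : A} (hp : IsALP x p) : IsARP (star x) p := by
  refine ⟨hp.1, ?_, fun y hy => ?_⟩
  · have := congrArg star hp.2.1
    rwa [star_mul, hp.1.1] at this
  · have h1 := congrArg star hy
    rw [star_mul, star_star, star_zero] at h1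
    have h2 := congrArg star (hp.2.2 _ h1)
    rwa [star_mul, star_star, hp.1.1, star_zero] at h2

theorem IsARP.commute_of_commute_star_mul_self {x p c : A} (hp : IsARP x p)
    (hc : Commute c (star x * x)) : Commute c p :=
  hp.of_star_mul_self.commute (IsSelfAdjoint.star_mul_self x) hc

theorem IsALP.commute_of_commute_mul_star_self {x p c : A} (hp : IsALP x p)
    (hc : Commute c (x * star x)) : Commute c p :=
  hp.star_isARP.commute_of_commute_star_mul_self (by rwa [star_star])

theorem WeaklyRickart.exists_isALP (hA : WeaklyRickart A) (x : A) : ∃ q, IsALP x q :=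
  let ⟨p, hp⟩ := hA (star x)
  ⟨p, hp.star_isALP⟩

/-- If `star b * b = star x * x` then `b` and `x` have the same annihilating right projection. -/
theorem IsARP.of_star_mul_self_eq {x b p : A} (hp : IsARP x p) (hb : star b * b = star x * x) :
    IsARP b p := by
  refine ⟨hp.1, ?_, fun y hy => hp.2.2 y ?_⟩
  · rw [← sub_eq_zero, ← CStarRing.star_mul_self_eq_zero_iff, star_sub, star_mul, hp.1.1,
      sub_mul, mul_sub, mul_sub, mul_assoc p, ← mul_assoc (star b) b p, hb, mul_assoc (star x),
      hp.2.1, mul_assoc p, hb, sub_self, sub_self, sub_zero]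
  · rw [← CStarRing.star_mul_self_eq_zero_iff, star_mul, mul_assoc, ← mul_assoc _ x, ← hb,
      mul_assoc, hy, mul_zero, mul_zero]

end Annihilators

section DyadicExpansion

variable {A : Type*} [NonUnitalCStarAlgebra A] [PartialOrder A] [StarOrderedRing A]

theorem sub_proj_mul_nonneg {z e : A} (hz : 0 ≤ z) (he : IsProjection e) (hc : Commute z e) :
    0 ≤ z - e * z := by
  have hs : Commute (CFC.sqrt z) e := by
    exact Commute.cfcₙ_nnreal hc _
  have h := star_mul_self_nonneg (CFC.sqrt z - e * CFC.sqrt z)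
  have hsa : star (CFC.sqrt z) = CFC.sqrt z := (CFC.sqrt_nonneg z).isSelfAdjoint.star_eq
  have h2 : CFC.sqrt z * CFC.sqrt z = z := CFC.sqrt_mul_sqrt_self z
  convert h using 1
  have h3 := he.2
  rw [star_sub, star_mul, hsa, he.1, hs.eq, sub_mul, mul_sub, mul_sub, h2]
  have h4 : CFC.sqrt z * (e * CFC.sqrt z) = e * z := by rw [← mul_assoc, hs.eq, mul_assoc, h2]
  have h5 : e * CFC.sqrt z * CFC.sqrt z = e * z := by rw [mul_assoc, h2]
  have h6 : e * CFC.sqrt z * (e * CFC.sqrt z) = e * z := by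
    rw [mul_assoc, h4, ← mul_assoc, h3]
  rw [h4, h5, h6]; abel

theorem exists_projection_dyadic_step (hA : WeaklyRickart A) {b z : A} (hz : 0 ≤ z) (hzb : z ≤ b)
    (hc : Commute z b) : ∃ e : A, IsProjection e ∧ 0 ≤ z + z - e * b ∧ z + z - e * b ≤ b ∧
      Commute (z + z - e * b) b := by
  have hb : 0 ≤ b := hz.trans hzb
  set h := z + z - b with hh
  have hsa : IsSelfAdjoint h := (hz.isSelfAdjoint.add hz.isSelfAdjoint).sub hb.isSelfAdjoint
  obtain ⟨e, he⟩ := hA h⁺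
  have hpsa : IsSelfAdjoint h⁺ := (CFC.posPart_nonneg h).isSelfAdjoint
  have hzh : Commute h z := ((Commute.refl z).add_left (Commute.refl z)).sub_left hc.symm
  have hbh : Commute h b := (hc.add_left hc).sub_left (Commute.refl b)
  have hze : Commute z e := he.commute hpsa (by
    rw [CFC.posPart_def]; exact (Commute.cfcₙ_real hzh _).symm)
  have hbe : Commute b e := he.commute hpsa (by
    rw [CFC.posPart_def]; exact (Commute.cfcₙ_real hbh _).symm)
  have e1 : e * h⁺ = h⁺ := he.mul_left_of_isSelfAdjoint hpsa
  have e2 : e * h⁻ = 0 := he.2.2 _ (CFC.posPart_mul_negPart h)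
  have e3 : h⁺ - h⁻ = h := CFC.posPart_sub_negPart h hsa
  have e4 : e * h = h⁺ := by
    calc e * h = e * (h⁺ - h⁻) := by rw [e3]
      _ = h⁺ := by rw [mul_sub, e1, e2, sub_zero]
  have e5 : e * h = e * z + e * z - e * b := by rw [hh, mul_sub, mul_add]
  refine ⟨e, he.1, ?_, ?_, ?_⟩
  · have k := sub_proj_mul_nonneg hz he.1 hze
    have : z + z - e * b = h⁺ + ((z - e * z) + (z - e * z)) := by
      rw [← e4, e5]; abel
    rw [this]
    exact add_nonneg (CFC.posPart_nonneg h) (add_nonneg k k)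
  · rw [← sub_nonneg]
    have k : 0 ≤ e * (b - z) := by
      have := star_left_conjugate_nonneg (sub_nonneg.2 hzb) e
      rwa [he.1.1, mul_assoc, (hbe.sub_left hze).eq, ← mul_assoc, he.1.2] at this
    have : b - (z + z - e * b) = h⁻ + (e * (b - z) + e * (b - z)) := by
      have : h⁻ = h⁺ - h := by rw [eq_sub_iff_add_eq, ← sub_eq_iff_eq_add'.1 e3]
      rw [this, ← e4, e5, mul_sub, hh]; abel
    rw [this]
    exact add_nonneg (CFC.negPart_nonneg h) (add_nonneg k k)
  · exact (hc.add_left hc).sub_left (hbe.symm.mul_left (Commute.refl b))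

/-- A positive element dominated by `b` and commuting with `b` is a left multiple of `b`. -/
theorem exists_mul_eq_of_commute_of_le (hA : WeaklyRickart A) {b z : A} (hz : 0 ≤ z) (hzb : z ≤ b)
    (hc : Commute z b) : ∃ y : A, y * b = z := by
  have hstep : ∀ s : {z : A // 0 ≤ z ∧ z ≤ b ∧ Commute z b}, ∃ e : A, IsProjection e ∧
      0 ≤ s.1 + s.1 - e * b ∧ s.1 + s.1 - e * b ≤ b ∧ Commute (s.1 + s.1 - e * b) b :=
    fun s => exists_projection_dyadic_step hA s.2.1 s.2.2.1 s.2.2.2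
  choose E hE hE1 using hstep
  let s : ℕ → {z : A // 0 ≤ z ∧ z ≤ b ∧ Commute z b} :=
    Nat.rec ⟨z, hz, hzb, hc⟩ (fun _ s => ⟨_, hE1 s⟩)
  have hs0 : (s 0).1 = z := rfl
  have hs1 : ∀ k, (s (k + 1)).1 = (s k).1 + (s k).1 - E (s k) * b := fun k => rfl
  let f : ℕ → A := fun k => ((1 / 2 : ℝ) ^ (k + 1)) • E (s k)
  have hfs : Summable f := by
    refine Summable.of_norm_bounded (g := fun k => (1 / 2 : ℝ) ^ k * (1 / 2))
      (summable_geometric_two.mul_right _) fun k => ?_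
    rw [norm_smul, norm_pow, pow_succ]
    have := (hE (s k)).norm_le_one
    have h2 : ‖(1 / 2 : ℝ)‖ = 1 / 2 := by norm_num
    rw [h2]
    exact mul_le_of_le_one_right (by positivity) this
  have hpart : ∀ n, (∑ k ∈ Finset.range n, f k) * b = z - ((1 / 2 : ℝ) ^ n) • (s n).1 := by
    intro n
    induction n with
    | zero => simp [hs0]
    | succ n ih =>
      rw [Finset.sum_range_succ, add_mul, ih, hs1]
      simp only [f, smul_mul_assoc, smul_sub, smul_add, pow_succ]
      have : ((1 / 2 : ℝ) ^ n) • (s n).1 = ((1 / 2 : ℝ) ^ n * (1 / 2)) • (s n).1 +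
        ((1 / 2 : ℝ) ^ n * (1 / 2)) • (s n).1 := by rw [← add_smul]; ring_nf
      rw [this]; abel
  refine ⟨∑' k, f k, ?_⟩
  have h1 := (hfs.hasSum.mul_right b).tendsto_sum_nat
  simp only [← Finset.sum_mul, hpart] at h1
  have h2 : Filter.Tendsto (fun n => ((1 / 2 : ℝ) ^ n) • (s n).1) Filter.atTop (nhds 0) := by
    apply squeeze_zero_norm (a := fun n => (1 / 2 : ℝ) ^ n * ‖b‖)
    · intro n
      rw [norm_smul, norm_pow]
      have : ‖(1 / 2 : ℝ)‖ = 1 / 2 := by norm_num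
      rw [this]
      exact mul_le_mul_of_nonneg_left
        (CStarAlgebra.norm_le_norm_of_nonneg_of_le (s n).2.1 (s n).2.2.1) (by positivity)
    · have := (tendsto_pow_atTop_nhds_zero_of_lt_one (r := (1 / 2 : ℝ)) (by norm_num)
        (by norm_num)).mul_const ‖b‖
      simpa using this
  have h3 := (tendsto_const_nhds (x := z)).sub h2
  rw [sub_zero] at h3
  exact tendsto_nhds_unique h1 h3

end DyadicExpansion

section DyadicExpansion

variable {A : Type*} [NonUnitalCStarAlgebra A] [PartialOrder A] [StarOrderedRing A]

theorem exists_mul_eq_add_star (hA : WeaklyRickart A) {b P g : A} (hb : 0 ≤ b) (hP : IsARP b P)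
    (hc : Commute g b) (hgP : g * P = g) (hg : star g * g ≤ b * b) :
    ∃ y : A, y * b = g + star g := by
  have hbs : star b = b := hb.isSelfAdjoint.star_eq
  have hc' : Commute (star g) b := by
    have := congrArg star hc.eq
    rw [star_mul, star_mul, hbs] at this
    exact this.symm
  have hgP' : star g * P = star g := by
    have h1 : Commute g P := hP.commute hb.isSelfAdjoint hc
    have := congrArg star (h1.eq.symm.trans hgP)
    rwa [star_mul, hP.1.1] at this
  have hk1 : 0 ≤ b * b + b * b + (g + star g) * b := by
    have := add_nonneg (star_mul_self_nonneg (g + b)) (sub_nonneg.2 hg)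
    convert this using 1
    simp only [star_add, add_mul, mul_add, hbs, ← hc.eq]
    abel
  have hk2 : 0 ≤ b * b + b * b - (g + star g) * b := by
    have := add_nonneg (star_mul_self_nonneg (g - b)) (sub_nonneg.2 hg)
    convert this using 1
    simp only [star_sub, add_mul, sub_mul, mul_sub, hbs, ← hc.eq]
    abel
  obtain ⟨y, hy⟩ := exists_mul_eq_of_commute_of_le hA (b := b * b)
    (z := (1 / 4 : ℝ) • (b * b + b * b + (g + star g) * b)) (smul_nonneg (by norm_num) hk1)
    (by
      rw [← sub_nonneg]
      convert smul_nonneg (show (0 : ℝ) ≤ 1 / 4 by norm_num) hk2 using 1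
      module)
    (by
      refine Commute.smul_left ?_ _
      have h1 : Commute b (b * b) := (Commute.refl b).mul_right (Commute.refl b)
      have h2 : Commute (g + star g) (b * b) :=
        (hc.add_left hc').mul_right (hc.add_left hc')
      exact (((h1.mul_left h1).add_left (h1.mul_left h1)).add_left (h2.mul_left h1)))
  refine ⟨(4 : ℝ) • y - P - P, ?_⟩
  have hz : ((4 : ℝ) • (y * b) - b - b - (g + star g)) * b = 0 := by
    rw [sub_mul, sub_mul, sub_mul, smul_mul_assoc, mul_assoc, hy, smul_smul]
    norm_num
    abel
  have h2 := hP.mul_right_eq_zero hb.isSelfAdjoint hz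
  rw [sub_mul, sub_mul, sub_mul, smul_mul_assoc, mul_assoc, hP.2.1, add_mul, hgP, hgP',
    sub_eq_zero] at h2
  rw [sub_mul, sub_mul, smul_mul_assoc, hP.mul_left_of_isSelfAdjoint hb.isSelfAdjoint, h2]

/-- An element `g` commuting with `b ≥ 0` and with `star g * g ≤ b * b` is a left multiple
of `b`. -/
theorem exists_mul_eq_of_commute (hA : WeaklyRickart A) {b P g : A} (hb : 0 ≤ b) (hP : IsARP b P)
    (hc : Commute g b) (hgP : g * P = g) (hg : star g * g ≤ b * b) : ∃ y : A, y * b = g := by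
  obtain ⟨y₁, h₁⟩ := exists_mul_eq_add_star hA hb hP hc hgP hg
  obtain ⟨y₂, h₂⟩ := exists_mul_eq_add_star hA hb hP (hc.smul_left Complex.I)
    (by rw [smul_mul_assoc, hgP]) (by
      convert hg using 1
      rw [star_smul, smul_mul_smul_comm]
      simp)
  refine ⟨(1 / 2 : ℂ) • (y₁ - Complex.I • y₂), ?_⟩
  rw [smul_mul_assoc, sub_mul, smul_mul_assoc, h₁, h₂, star_smul]
  have : star Complex.I = -Complex.I := Complex.conj_I
  rw [this, smul_add, smul_smul, smul_smul, Complex.I_mul_I]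
  have : Complex.I * -Complex.I = 1 := by rw [mul_neg, Complex.I_mul_I, neg_neg]
  rw [this]
  module

end DyadicExpansion

section PolarDecomposition

theorem mul_mul_eq_of_mul_eq {S : Type*} [Semigroup S] {a b c : S} (h : a * b = c) (z : S) :
    a * (b * z) = c * z := by
  rw [← mul_assoc, h]

section CStar

variable {A : Type*} [NonUnitalCStarAlgebra A]

theorem mul_star_eq_zero_of_mul_star_mul_self {D Y : A} (h : D * (star Y * Y) = 0) :
    D * star Y = 0 := by
  rw [← CStarRing.mul_star_self_eq_zero_iff, star_mul, star_star, mul_assoc,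
    ← mul_assoc (star Y), ← mul_assoc, h, zero_mul]

theorem mul_projection_eq_self_of_star_mul_self {c P : A} (hP : IsProjection P)
    (h : star c * c * P = star c * c) : c * P = c := by
  have h' : P * (star c * c) = star c * c := by
    have := congrArg star h
    simpa only [star_mul, star_star, hP.1] using this
  have h1 : star c * (c * P) = star c * c := by rw [← mul_assoc, h]
  rw [← sub_eq_zero, ← CStarRing.star_mul_self_eq_zero_iff, star_sub, star_mul, hP.1,
    sub_mul, mul_sub, mul_sub, mul_assoc P, h1, mul_assoc P, h', sub_self]

theorem IsProjection.star_sub_mul_sub {Q : A} (hQ : IsProjection Q) (x : A) :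
    star (x - Q * x) * (x - Q * x) = star x * x - star x * (Q * x) := by
  have h := mul_mul_eq_of_mul_eq hQ.2
  simp only [star_sub, star_mul, hQ.1, sub_mul, mul_sub, mul_assoc, h]
  abel

/-- A factorization `x = w * b` through the absolute value `b` of `x` yields the polar
decomposition of `x`. -/
theorem exists_partialIsometry_of_mul_eq {x b w P : A} (hb : star b = b)
    (hbx : b * b = star x * x) (hP : IsARP b P) (hw : w * b = x) :
    ∃ e : A, star e * e = P ∧ IsProjection (e * star e) ∧ IsALP x (e * star e) ∧ e * b = x ∧
      star e * x = b := by
  have hPb : P * b = b := hP.mul_left_of_isSelfAdjoint hb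
  have hPs := hP.1.1
  have hPP := hP.1.2
  have hb' : b * (star w * (w * b)) = b * b := by
    rw [hw, hbx, ← hw, star_mul, hb, mul_assoc]
  have h1 : (P * star w * (w * P)) * b = b := by
    have h2 : b * (P * star w * (w * P) * b - b) = 0 := by
      have := mul_mul_eq_of_mul_eq hP.2.1
      simp only [mul_sub, mul_assoc, this, hPb, hb', sub_self]
    have h3 := hP.2.2 _ h2
    rw [mul_sub, hPb] at h3
    rw [← sub_eq_zero, ← h3]
    simp only [mul_assoc, mul_mul_eq_of_mul_eq hPP]
  have h4 : star (w * P) * (w * P) = P := by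
    rw [star_mul, hPs]
    have h5 : (P * star w * (w * P) - P) * b = 0 := by rw [sub_mul, h1, hPb, sub_self]
    have h6 := hP.mul_right_eq_zero hb h5
    rw [sub_mul, hPP, sub_eq_zero] at h6
    conv_rhs => rw [← h6]
    simp only [mul_assoc, hPP]
  have h7 : w * P * b = x := by rw [mul_assoc, hPb, hw]
  have h8 : w * P * P = w * P := by rw [mul_assoc, hPP]
  generalize w * P = e at *
  have h9 : IsProjection (e * star e) := by
    refine ⟨by rw [star_mul, star_star], ?_⟩
    rw [mul_assoc, ← mul_assoc (star e), h4, ← mul_assoc, h8]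
  refine ⟨e, h4, h9, ⟨h9, ?_, fun y hy => ?_⟩, h7, ?_⟩
  · rw [← h7, mul_assoc, ← mul_assoc (star e), h4, hPb]
  · rw [← h7, ← mul_assoc] at hy
    have := hP.mul_right_eq_zero hb hy
    rw [mul_assoc, h8] at this
    rw [← mul_assoc, this, zero_mul]
  · rw [← h7, ← mul_assoc, h4, hPb]

end CStar

variable {A : Type*} [NonUnitalCStarAlgebra A] [PartialOrder A] [StarOrderedRing A]

theorem exists_mul_eq_of_mul_self_eq_zero (hA : WeaklyRickart A) {Z b : A} (hZ : Z * Z = 0)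
    (hb : 0 ≤ b) (hbZ : b * b = star Z * Z) : ∃ w : A, w * b = Z := by
  have hbs : star b = b := hb.isSelfAdjoint.star_eq
  set h := Z + star Z with hh
  have hsa : IsSelfAdjoint h := by
    rw [isSelfAdjoint_iff, hh, star_add, star_star, add_comm]
  have hZ' : star Z * star Z = 0 := by rw [← star_mul, hZ, star_zero]
  set c := CFC.sqrt (Z * star Z)
  have hc : 0 ≤ c := CFC.sqrt_nonneg _
  have hcs : star c = c := hc.isSelfAdjoint.star_eq
  have hcc : c * c = Z * star Z := CFC.sqrt_mul_sqrt_self _ (mul_star_self_nonneg Z)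
  have hbc : b * c = 0 := by
    have h1 : b * b * (star c * c) = 0 := by
      rw [hcs, hcc, hbZ, mul_assoc, ← mul_assoc Z, hZ, zero_mul, mul_zero]
    have h2 := congrArg star (mul_star_eq_zero_of_mul_star_mul_self h1)
    rw [hcs, star_mul, star_mul, hcs, hbs, star_zero] at h2
    have h3 : c * (star b * b) = 0 := by rw [hbs, h2]
    have h4 := congrArg star (mul_star_eq_zero_of_mul_star_mul_self h3)
    rwa [star_mul, star_star, hcs, star_zero] at h4
  have hcb : c * b = 0 := by
    have := congrArg star hbc
    rwa [star_mul, hcs, hbs, star_zero] at this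
  have hpn : h⁺ * h⁻ = 0 := CFC.posPart_mul_negPart h
  have hnp : h⁻ * h⁺ = 0 := CFC.negPart_mul_posPart h
  have hd : h⁺ - h⁻ = h := CFC.posPart_sub_negPart h hsa
  have hp0 := CFC.posPart_nonneg h
  have hn0 := CFC.negPart_nonneg h
  have habs : h⁺ + h⁻ = b + c := by
    have e1 : (h⁺ + h⁻) * (h⁺ + h⁻) = h * h := by
      calc (h⁺ + h⁻) * (h⁺ + h⁻) = (h⁺ - h⁻) * (h⁺ - h⁻) := by
            simp only [mul_add, add_mul, mul_sub, sub_mul, hpn, hnp]; abel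
        _ = h * h := by rw [hd]
    have e2 : (b + c) * (b + c) = h * h := by
      simp only [hh, mul_add, add_mul, hZ, hZ', hbc, hcb, hbZ, hcc]; abel
    rw [← CFC.sqrt_unique e1 (add_nonneg hp0 hn0), ← CFC.sqrt_unique e2 (add_nonneg hb hc)]
  obtain ⟨E, hE⟩ := hA h⁺
  obtain ⟨F, hF⟩ := hA h⁻
  have hJ : (E - F) * (b + c) = Z + star Z := by
    rw [← habs, sub_mul, mul_add, mul_add, hE.mul_left_of_isSelfAdjoint hp0.isSelfAdjoint,
      hF.mul_left_of_isSelfAdjoint hn0.isSelfAdjoint, hE.2.2 _ hpn, hF.2.2 _ hnp, add_zero,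
      zero_add, hd]
  generalize E - F = J at hJ
  refine ⟨J, ?_⟩
  have hD : (J * b - Z) * (b * b) = 0 := by
    have h1 := congrArg (· * (b * b)) hJ
    have h2 : c * (b * b) = 0 := by rw [← mul_assoc, hcb, zero_mul]
    have h3 : star Z * (b * b) = 0 := by rw [hbZ, ← mul_assoc, hZ', zero_mul]
    simp only [mul_add, add_mul, mul_assoc, h2, h3, mul_zero, add_zero] at h1
    rw [sub_mul, mul_assoc, h1, sub_self]
  have hDZ := mul_star_eq_zero_of_mul_star_mul_self (hbZ ▸ hD)
  have hDb := mul_star_eq_zero_of_mul_star_mul_self (Y := b) (by rw [hbs]; exact hD)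
  rw [← sub_eq_zero, ← CStarRing.mul_star_self_eq_zero_iff, star_sub, star_mul, mul_sub,
    ← mul_assoc, hDb, hDZ, zero_mul, sub_zero]

theorem exists_mul_eq_of_commute_projection_mul (hA : WeaklyRickart A) {x b P : A} (hb : 0 ≤ b)
    (hbx : b * b = star x * x) (hP : IsARP b P) (hc : Commute (P * x) b) :
    ∃ w : A, w * b = x := by
  have hbs : star b = b := hb.isSelfAdjoint.star_eq
  have hxP : x * P = x := mul_projection_eq_self_of_star_mul_self hP.1 (by
    rw [← hbx, mul_assoc, hP.2.1])
  have hgg : star (P * x) * (P * x) = star x * (P * x) := by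
    rw [star_mul, hP.1.1, mul_assoc, mul_mul_eq_of_mul_eq hP.1.2]
  have hzz := hP.1.star_sub_mul_sub x
  obtain ⟨y, hy⟩ := exists_mul_eq_of_commute hA hb hP hc (by rw [mul_assoc, hxP]) (by
    rw [hgg, ← sub_nonneg, hbx, ← hzz]
    exact star_mul_self_nonneg _)
  set z := x - P * x with hz
  have hz2 : z * z = 0 := by
    simp only [hz, mul_sub, sub_mul, mul_assoc, mul_mul_eq_of_mul_eq hxP]
    abel
  set c := CFC.sqrt (star z * z) with hcdef
  have hc0 : 0 ≤ c := CFC.sqrt_nonneg _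
  have hcs : star c = c := hc0.isSelfAdjoint.star_eq
  have hcc : c * c = star z * z := CFC.sqrt_mul_sqrt_self _ (star_mul_self_nonneg z)
  have hcc' : c * c = b * b - star (P * x) * (P * x) := by rw [hcc, hzz, hgg, hbx]
  have hcb : Commute c b := by
    refine Commute.cfcₙ_nnreal ?_ _
    rw [← hcc, hcc']
    have : Commute (star (P * x)) b := by
      have := congrArg star hc.eq
      rw [star_mul, star_mul b, hbs] at this
      exact this.symm
    exact ((Commute.refl b).mul_left (Commute.refl b)).sub_left (this.mul_left hc)
  obtain ⟨W, hW⟩ := exists_mul_eq_of_mul_self_eq_zero hA hz2 hc0 hcc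
  obtain ⟨d, hd⟩ := exists_mul_eq_of_commute hA hb hP hcb
    (mul_projection_eq_self_of_star_mul_self hP.1 (by
      rw [hcs, hcc, hzz, sub_mul, ← hbx, mul_assoc, hP.2.1, mul_assoc, mul_assoc P, hxP]))
    (by
      rw [hcs, hcc', sub_le_self_iff]
      exact star_mul_self_nonneg _)
  exact ⟨W * d + y, by rw [add_mul, mul_assoc, hd, hW, hy, hz, sub_add_cancel]⟩

theorem exists_mul_eq_of_orthogonal_copy (hA : WeaklyRickart A) {z b P V : A} (hb : 0 ≤ b)
    (hP : IsARP b P) (hzP : z * P = z) (hPz : P * z = 0) (hzb : star z * z ≤ b * b)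
    (hV : star V * V = P) (hPV : P * V = 0) (hVz : star V * z = 0) : ∃ y : A, y * b = z := by
  have hzV : star z * V = 0 := by
    have := congrArg star hVz
    rwa [star_mul, star_star, star_zero] at this
  have hVP : V * P = V := mul_projection_eq_self_of_star_mul_self hP.1 (by rw [hV, hP.1.2])
  set c := CFC.sqrt (b * b - star z * z)
  have hc0 : 0 ≤ c := CFC.sqrt_nonneg _
  have hcs : star c = c := hc0.isSelfAdjoint.star_eq
  have hcc : c * c = b * b - star z * z := CFC.sqrt_mul_sqrt_self _ (sub_nonneg.2 hzb)
  have hcP : c * P = c := mul_projection_eq_self_of_star_mul_self hP.1 (by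
    rw [hcs, hcc, sub_mul, mul_assoc, mul_assoc, hzP, hP.2.1])
  have hPc : P * c = c := by
    have := congrArg star hcP
    rwa [star_mul, hcs, hP.1.1] at this
  have hZP : (z + V * c) * P = z + V * c := by rw [add_mul, mul_assoc, hcP, hzP]
  have hPZ : P * (z + V * c) = 0 := by rw [mul_add, ← mul_assoc, hPV, hPz, zero_mul, add_zero]
  obtain ⟨W, hW⟩ := exists_mul_eq_of_mul_self_eq_zero hA (Z := z + V * c) (b := b)
    (by rw [← hZP, mul_assoc, hZP, hPZ, mul_zero]) hb (by
      simp only [star_add, star_mul, hcs, mul_add, add_mul, mul_assoc, hVz,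
        mul_mul_eq_of_mul_eq hzV, mul_mul_eq_of_mul_eq hV, hPc, hcc, mul_zero, zero_mul]
      abel)
  refine ⟨W - V * (star V * W), ?_⟩
  simp only [sub_mul, mul_assoc, hW, mul_add, mul_mul_eq_of_mul_eq hV, hVz,
    mul_mul_eq_of_mul_eq hVP, mul_zero]
  abel

theorem exists_mul_eq_of_two_orthogonal_copies (hA : WeaklyRickart A) {x b P V₁ V₂ : A}
    (hb : 0 ≤ b) (hbx : b * b = star x * x) (hP : IsARP b P) (hV₁ : star V₁ * V₁ = P)
    (hV₂ : star V₂ * V₂ = P) (hPV₁ : P * V₁ = 0) (hPV₂ : P * V₂ = 0) (hV : star V₁ * V₂ = 0) :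
    ∃ w : A, w * b = x := by
  have hxP : x * P = x := mul_projection_eq_self_of_star_mul_self hP.1 (by
    rw [← hbx, mul_assoc, hP.2.1])
  have hVP₁ : V₁ * P = V₁ := mul_projection_eq_self_of_star_mul_self hP.1 (by rw [hV₁, hP.1.2])
  have star_left : ∀ {V : A}, P * V = 0 → star V * P = 0 := fun h => by
    simpa [hP.1.1] using congrArg star h
  have star_right : ∀ {V : A}, V * P = V → P * star V = star V := fun h => by
    simpa [hP.1.1] using congrArg star h
  have hV' : star V₂ * V₁ = 0 := by simpa using congrArg star hV
  have hle : ∀ Q : A, IsProjection Q → star x * (Q * x) ≤ b * b := fun Q hQ => by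
    rw [← sub_nonneg, hbx, ← hQ.star_sub_mul_sub]
    exact star_mul_self_nonneg _
  have hle' : ∀ Q : A, IsProjection Q → star (x - Q * x) * (x - Q * x) ≤ b * b := fun Q hQ => by
    rw [hQ.star_sub_mul_sub, hbx, sub_le_self_iff]
    simpa [hQ.1, mul_assoc, mul_mul_eq_of_mul_eq hQ.2] using star_mul_self_nonneg (Q * x)
  have proj : IsProjection (V₁ * star V₁) := by
    refine ⟨by simp, ?_⟩
    simp only [mul_assoc, mul_mul_eq_of_mul_eq hV₁, star_right hVP₁]
  have proj' : IsProjection (P + V₁ * star V₁) := by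
    refine ⟨by simp [hP.1.1], ?_⟩
    simp only [mul_assoc, mul_mul_eq_of_mul_eq hV₁, star_right hVP₁, mul_add, add_mul, hP.1.2,
      mul_mul_eq_of_mul_eq hPV₁, star_left hPV₁, mul_zero, zero_mul]
    abel
  obtain ⟨y₁, hy₁⟩ := exists_mul_eq_of_orthogonal_copy hA (z := x - (P + V₁ * star V₁) * x)
    hb hP (by rw [sub_mul, mul_assoc, hxP])
    (by
      simp only [mul_sub, add_mul, mul_add, mul_assoc, mul_mul_eq_of_mul_eq hP.1.2,
        mul_mul_eq_of_mul_eq hPV₁, zero_mul]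
      abel)
    (hle' _ proj') hV₁ hPV₁
    (by
      simp only [mul_sub, add_mul, mul_add, mul_assoc, mul_mul_eq_of_mul_eq hV₁,
        mul_mul_eq_of_mul_eq (star_left hPV₁), mul_mul_eq_of_mul_eq (star_right hVP₁), zero_mul]
      abel)
  obtain ⟨y₂, hy₂⟩ := exists_mul_eq_of_orthogonal_copy hA (z := V₂ * (P * x))
    hb hP (by simp only [mul_assoc, hxP]) (by rw [mul_mul_eq_of_mul_eq hPV₂, zero_mul])
    (by
      convert hle P hP.1 using 1
      simp only [star_mul, hP.1.1, mul_assoc, mul_mul_eq_of_mul_eq hV₂,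
        mul_mul_eq_of_mul_eq hP.1.2])
    hV₁ hPV₁ (by rw [mul_mul_eq_of_mul_eq hV, zero_mul])
  obtain ⟨y₃, hy₃⟩ := exists_mul_eq_of_orthogonal_copy hA (z := V₁ * (star V₁ * x))
    hb hP (by simp only [mul_assoc, hxP]) (by rw [mul_mul_eq_of_mul_eq hPV₁, zero_mul])
    (by
      convert hle _ proj using 1
      simp only [star_mul, star_star, mul_assoc, mul_mul_eq_of_mul_eq hV₁,
        mul_mul_eq_of_mul_eq (star_right hVP₁)])
    hV₂ hPV₂ (by rw [mul_mul_eq_of_mul_eq hV', zero_mul])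
  refine ⟨y₁ + star V₂ * y₂ + y₃, ?_⟩
  simp only [add_mul, mul_assoc, hy₁, hy₂, hy₃, mul_mul_eq_of_mul_eq hV₂,
    mul_mul_eq_of_mul_eq hP.1.2]
  abel

end PolarDecomposition

section Exhaustion

variable {A : Type*} [NonUnitalCStarAlgebra A]

theorem exists_sum_of_orthogonal {y : ℕ → A} (hy : ∀ j k, y j * y k = 0)
    (hl : ∀ j k, j ≠ k → star (y j) * y k = 0) (hr : ∀ j k, j ≠ k → y j * star (y k) = 0) :
    ∃ X : A, X * X = 0 ∧ (∀ c, c * X = 0 → ∀ k, c * y k = 0) ∧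
      (∀ c, X * c = 0 → ∀ k, y k * c = 0) ∧
      (∀ c, (∀ k, Commute c (star (y k) * y k)) → Commute c (star X * X)) ∧
      (∀ c, (∀ k, Commute c (y k * star (y k))) → Commute c (X * star X)) ∧
      (∀ c, (∀ k, c * y k = y k) → c * X = X) ∧ (∀ c, (∀ k, y k * c = y k) → X * c = X) := by
  let a : ℕ → ℝ := fun k => (1 / 2) ^ k / (1 + ‖y k‖)
  have ha : ∀ k, 0 < a k := fun k => by positivity
  have hs : Summable fun k => a k • y k := by
    refine Summable.of_norm_bounded summable_geometric_two fun k => ?_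
    rw [norm_smul, Real.norm_of_nonneg (ha k).le, div_mul_eq_mul_div]
    refine div_le_of_le_mul₀ (by positivity) (by positivity) ?_
    have : 0 ≤ ‖y k‖ := norm_nonneg _
    gcongr
    linarith
  let X := ∑' k, a k • y k
  have hXr : ∀ c, X * c = ∑' k, a k • (y k * c) := fun c => by
    simp only [← smul_mul_assoc]
    exact (hs.tsum_mul_right c).symm
  have hXl : ∀ c, c * X = ∑' k, a k • (c * y k) := fun c => by
    simp only [← mul_smul_comm]
    exact (hs.tsum_mul_left c).symm
  have hX1 : ∀ k, X * star (y k) = a k • (y k * star (y k)) := fun k => by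
    rw [hXr, tsum_eq_single k fun j hj => by rw [hr j k hj, smul_zero]]
  have hX2 : ∀ k, star (y k) * X = a k • (star (y k) * y k) := fun k => by
    rw [hXl, tsum_eq_single k fun j hj => by rw [hl k j hj.symm, smul_zero]]
  have hX1' : ∀ k, y k * star X = a k • (y k * star (y k)) := fun k => by
    simpa using congrArg star (hX1 k)
  refine ⟨X, ?_, fun c hc k => ?_, fun c hc k => ?_, fun c hc => ?_, fun c hc => ?_,
    fun c hc => ?_, fun c hc => ?_⟩
  · have : ∀ k, y k * X = 0 := fun k => by simp [hXl, hy]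
    simp [hXr, this]
  · have h1 : c * (a k • (y k * star (y k))) = 0 := by
      rw [← hX1, ← mul_assoc, hc, zero_mul]
    rw [mul_smul_comm, smul_eq_zero_iff_right (ha k).ne'] at h1
    have := mul_star_eq_zero_of_mul_star_mul_self (D := c) (Y := star (y k))
      (by rwa [star_star])
    rwa [star_star] at this
  · have h1 : (a k • (star (y k) * y k)) * c = 0 := by
      rw [← hX2, mul_assoc, hc, mul_zero]
    rw [smul_mul_assoc, smul_eq_zero_iff_right (ha k).ne'] at h1
    rw [← CStarRing.star_mul_self_eq_zero_iff, star_mul, mul_assoc, ← mul_assoc _ (y k), h1,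
      mul_zero]
  · have : star X * X = ∑' k, a k • a k • (star (y k) * y k) := by
      rw [hXl]
      refine tsum_congr fun k => ?_
      have := congrArg star (hX2 k)
      rw [star_mul, star_star] at this
      rw [this]
      simp
    rw [this]
    exact Commute.tsum_right _ fun k => ((hc k).smul_right _).smul_right _
  · have : X * star X = ∑' k, a k • a k • (y k * star (y k)) := by
      rw [hXr]
      exact tsum_congr fun k => by rw [hX1']
    rw [this]
    exact Commute.tsum_right _ fun k => ((hc k).smul_right _).smul_right _
  · rw [hXl]; simp only [hc]; rfl
  · rw [hXr]; simp only [hc]; rfl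

theorem IsProjection.sub_of_mul_eq {P S : A} (hP : IsProjection P) (hS : IsProjection S)
    (h : P * S = S) : IsProjection (P - S) := by
  have h' : S * P = S := by simpa [hP.1, hS.1] using congrArg star h
  refine ⟨by rw [star_sub, hP.1, hS.1], ?_⟩
  simp only [sub_mul, mul_sub, hP.2, hS.2, h, h']
  abel

theorem IsProjection.add_of_mul_eq_zero {R S : A} (hR : IsProjection R) (hS : IsProjection S)
    (h : S * R = 0) : IsProjection (S + R) := by
  have h' : R * S = 0 := by simpa [hR.1, hS.1] using congrArg star h
  refine ⟨by rw [star_add, hR.1, hS.1], ?_⟩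
  simp only [add_mul, mul_add, hR.2, hS.2, h, h']
  abel

theorem IsARP.mul_eq_self {y T R : A} (hR : IsARP y R) (hT : IsProjection T) (h : y * T = y) :
    T * R = R := by
  have hc : Commute T R := hR.commute_of_commute_star_mul_self (by
    have h' : T * star y = star y := by simpa [hT.1] using congrArg star h
    rw [commute_iff_eq, ← mul_assoc, h', mul_assoc, h])
  have h1 : y * (R - T * R) = 0 := by rw [mul_sub, ← mul_assoc, h, sub_self]
  have h2 := hR.2.2 _ h1
  rw [mul_sub, hR.1.2, ← mul_assoc, ← hc.eq, mul_assoc, hR.1.2, sub_eq_zero] at h2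
  exact h2.symm

theorem IsALP.mul_eq_self {y T S : A} (hS : IsALP y S) (hT : IsProjection T) (h : T * y = y) :
    T * S = S :=
  hS.star_isARP.mul_eq_self hT (by simpa [hT.1] using congrArg star h)

theorem IsALP.mul_eq_zero_of_mul_self {y S R : A} (hS : IsALP y S) (hR : IsARP y R)
    (hy : y * y = 0) : S * R = 0 ∧ R * S = 0 ∧ y * S = 0 ∧ R * y = 0 := by
  have h1 := hR.2.2 _ hy
  have h2 := hS.2.2 _ h1
  exact ⟨by simpa [hS.1.1, hR.1.1] using congrArg star h2, h2, hS.2.2 _ hy, h1⟩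

theorem exists_projection_orthogonal_to_corner (hA : WeaklyRickart A) {p : ℕ → A}
    (hp : ∀ n, IsProjection (p n)) (hpp : ∀ m n, m ≠ n → p m * p n = 0) {T : A}
    (hT : IsProjection T) (hTp : ∀ n, Commute T (p n)) {m n : ℕ} (hmn : m ≠ n) (w : A) :
    ∃ T' : A, IsProjection T' ∧ (∀ n, Commute T' (p n)) ∧ T * T' = T' ∧
      T * p m * w * p n * T * T' = 0 ∧ T' * (T * p m * w * p n * T) = 0 ∧
      ∀ s, IsProjection s → s * T = s → s * (T * p m * w * p n * T) = 0 →
        T * p m * w * p n * T * s = 0 → s * T' = s := by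
  have e1 : T * (T * p m * w * p n * T) = T * p m * w * p n * T := by
    simp only [mul_assoc, mul_mul_eq_of_mul_eq hT.2]
  have e2 : T * p m * w * p n * T * T = T * p m * w * p n * T := by
    simp only [mul_assoc, hT.2]
  have e3 : p m * (T * p m * w * p n * T) = T * p m * w * p n * T := by
    simp only [mul_assoc, mul_mul_eq_of_mul_eq (hTp m).eq.symm, mul_mul_eq_of_mul_eq (hp m).2]
  have e4 : T * p m * w * p n * T * p n = T * p m * w * p n * T := by
    simp only [mul_assoc, (hTp n).eq, mul_mul_eq_of_mul_eq (hp n).2]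
  generalize T * p m * w * p n * T = y at *
  have hyy : y * y = 0 := by
    calc y * y = y * p n * (p m * y) := by rw [e3, e4]
      _ = 0 := by rw [mul_assoc, ← mul_assoc (p n), hpp n m hmn.symm, zero_mul, mul_zero]
  obtain ⟨R, hR⟩ := hA y
  obtain ⟨S, hS⟩ := hA.exists_isALP y
  obtain ⟨hSR, hRS, hyS, hRy⟩ := hS.mul_eq_zero_of_mul_self hR hyy
  have hTR := hR.mul_eq_self hT e2
  have hTS := hS.mul_eq_self hT e1
  have comm : ∀ (c : A) (k l : ℕ), p l * c = c → c * p l = c → Commute (p k) c := by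
    intro c k l h1 h2
    by_cases h : k = l
    · subst h; rw [commute_iff_eq, h1, h2]
    · rw [commute_iff_eq, ← h1, ← mul_assoc, hpp k l h, zero_mul, h1, ← h2, mul_assoc,
        hpp l k (Ne.symm h), mul_zero]
  have hRp : ∀ k, Commute (p k) R := fun k =>
    hR.commute_of_commute_star_mul_self (comm _ _ n (by
      have : p n * star y = star y := by simpa [(hp n).1] using congrArg star e4
      rw [← mul_assoc, this]) (by rw [mul_assoc, e4]))
  have hSp : ∀ k, Commute (p k) S := fun k =>
    hS.commute_of_commute_mul_star_self (comm _ _ m (by rw [← mul_assoc, e3]) (by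
      have : star y * p m = star y := by simpa [(hp m).1] using congrArg star e3
      rw [mul_assoc, this]))
  have hSRp := hR.1.add_of_mul_eq_zero hS.1 hSR
  refine ⟨T - (S + R), hT.sub_of_mul_eq hSRp (by rw [mul_add, hTS, hTR]), fun k =>
    (hTp k).sub_left ((hSp k).symm.add_left (hRp k).symm), ?_, ?_, ?_, fun s hs hsT hsy hys => ?_⟩
  · rw [mul_sub, hT.2, mul_add, hTS, hTR]
  · rw [mul_sub, e2, mul_add, hyS, hR.2.1, zero_add, sub_self]
  · rw [sub_mul, e1, add_mul, hRy, hS.2.1, add_zero, sub_self]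
  · have h1 := hS.2.2 _ hsy
    have h2 : s * R = 0 := by simpa [hs.1, hR.1.1] using congrArg star (hR.2.2 _ hys)
    rw [mul_sub, hsT, mul_add, h1, h2, add_zero, sub_zero]

end Exhaustion

section Exhaustion

variable {A : Type*} [NonUnitalCStarAlgebra A] [PartialOrder A] [StarOrderedRing A]

/-- Maximality argument: up to two equivalent orthogonal projections, the off-diagonal entries
of a sequence `w` with respect to the orthogonal projections `p` can be made to vanish. -/
theorem exists_equivalent_projections (hA : WeaklyRickart A) {p w : ℕ → A} {P : A}
    (hp : ∀ n, IsProjection (p n)) (hpp : ∀ m n, m ≠ n → p m * p n = 0) (hP : IsProjection P)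
    (hPp : ∀ n, Commute P (p n)) :
    ∃ R v t : A, IsProjection R ∧ IsProjection (v * star v) ∧ IsProjection t ∧ star v * v = R ∧
      R * v = 0 ∧ P * R = R ∧ P * v = v ∧ t + v * star v + R = P ∧
      (∀ n, Commute R (p n)) ∧ (∀ n, Commute (v * star v) (p n)) ∧ (∀ n, Commute t (p n)) ∧
      ∀ m n, m ≠ n → t * p m * w n * p n * t = 0 := by
  classical
  have step : ∀ (k : ℕ) (T : {T : A // IsProjection T ∧ ∀ n, Commute T (p n)}),
      ∃ T' : {T : A // IsProjection T ∧ ∀ n, Commute T (p n)}, T.1 * T'.1 = T'.1 ∧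
        ((Nat.unpair k).1 ≠ (Nat.unpair k).2 →
          T.1 * p (Nat.unpair k).1 * w (Nat.unpair k).2 * p (Nat.unpair k).2 * T.1 * T'.1 = 0 ∧
          T'.1 * (T.1 * p (Nat.unpair k).1 * w (Nat.unpair k).2 * p (Nat.unpair k).2 * T.1) = 0 ∧
          ∀ s, IsProjection s → s * T.1 = s →
            s * (T.1 * p (Nat.unpair k).1 * w (Nat.unpair k).2 * p (Nat.unpair k).2 * T.1) = 0 →
            T.1 * p (Nat.unpair k).1 * w (Nat.unpair k).2 * p (Nat.unpair k).2 * T.1 * s = 0 →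
            s * T'.1 = s) ∧
        ((Nat.unpair k).1 = (Nat.unpair k).2 → T' = T) := by
    intro k T
    by_cases h : (Nat.unpair k).1 = (Nat.unpair k).2
    · exact ⟨T, T.2.1.2, fun h' => absurd h h', fun _ => rfl⟩
    · obtain ⟨T', h1, h2, h3, h4⟩ := exists_projection_orthogonal_to_corner hA hp hpp T.2.1 T.2.2
        h (w (Nat.unpair k).2)
      exact ⟨⟨T', h1, h2⟩, h3, fun _ => h4, fun h' => absurd h' h⟩
  choose F hF1 hF2 hF3 using step
  let T : ℕ → {T : A // IsProjection T ∧ ∀ n, Commute T (p n)} :=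
    Nat.rec ⟨P, hP, hPp⟩ F
  have hT1 : ∀ k, T (k + 1) = F k (T k) := fun k => rfl
  let y : ℕ → A := fun k => if (Nat.unpair k).1 ≠ (Nat.unpair k).2 then
    (T k).1 * p (Nat.unpair k).1 * w (Nat.unpair k).2 * p (Nat.unpair k).2 * (T k).1 else 0
  have hTy : ∀ k, (T k).1 * y k = y k := fun k => by
    by_cases h : (Nat.unpair k).1 ≠ (Nat.unpair k).2
    · simp only [y, if_pos h, mul_assoc, mul_mul_eq_of_mul_eq (T k).2.1.2]
    · simp only [y, if_neg h, mul_zero]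
  have hyT : ∀ k, y k * (T k).1 = y k := fun k => by
    by_cases h : (Nat.unpair k).1 ≠ (Nat.unpair k).2
    · simp only [y, if_pos h, mul_assoc, (T k).2.1.2]
    · simp only [y, if_neg h, zero_mul]
  have hyT1 : ∀ k, y k * (T (k + 1)).1 = 0 ∧ (T (k + 1)).1 * y k = 0 := fun k => by
    by_cases h : (Nat.unpair k).1 ≠ (Nat.unpair k).2
    · simp only [y, if_pos h, hT1]
      exact ⟨(hF2 k (T k) h).1, (hF2 k (T k) h).2.1⟩
    · simp only [y, if_neg h, mul_zero, zero_mul, and_self]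
  have hyp : ∀ k, y k * p (Nat.unpair k).2 = y k ∧ p (Nat.unpair k).1 * y k = y k := fun k => by
    by_cases h : (Nat.unpair k).1 ≠ (Nat.unpair k).2
    · simp only [y, if_pos h]
      constructor
      · simp only [mul_assoc, ((T k).2.2 _).eq, mul_mul_eq_of_mul_eq (hp _).2]
      · simp only [mul_assoc, mul_mul_eq_of_mul_eq ((T k).2.2 _).eq.symm,
          mul_mul_eq_of_mul_eq (hp _).2]
    · simp only [y, if_neg h, mul_zero, zero_mul, and_self]
  have hyy : ∀ k, y k * y k = 0 := fun k => by
    by_cases h : (Nat.unpair k).1 ≠ (Nat.unpair k).2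
    · calc y k * y k = y k * p (Nat.unpair k).2 * (p (Nat.unpair k).1 * y k) := by
            rw [(hyp k).1, (hyp k).2]
        _ = 0 := by rw [mul_assoc, ← mul_assoc (p _) (p _), hpp _ _ h.symm, zero_mul, mul_zero]
    · simp only [y, if_neg h, mul_zero]
  have hstar : ∀ k, star (T k).1 = (T k).1 := fun k => (T k).2.1.1
  have hdec : ∀ j d, (T j).1 * (T (j + d)).1 = (T (j + d)).1 := fun j d => by
    induction d with
    | zero => exact (T j).2.1.2
    | succ d ih =>
      have h1 : (T (j + d)).1 * (T (j + d + 1)).1 = (T (j + d + 1)).1 := hF1 _ _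
      rw [← add_assoc, ← h1, ← mul_assoc, ih]
  have hdec' : ∀ j d, (T (j + d)).1 * (T j).1 = (T (j + d)).1 := fun j d => by
    simpa [hstar] using congrArg star (hdec j d)
  have horth : ∀ j k, j < k → y j * y k = 0 ∧ y k * y j = 0 ∧ star (y j) * y k = 0 ∧
      y j * star (y k) = 0 := by
    intro j k hjk
    obtain ⟨d, rfl⟩ := Nat.exists_eq_add_of_le (Nat.succ_le_of_lt hjk)
    have h1 : y (j + 1 + d) = (T (j + 1)).1 * y (j + 1 + d) := by
      rw [← hTy (j + 1 + d), ← mul_assoc, hdec (j + 1) d]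
    have h2 : y (j + 1 + d) = y (j + 1 + d) * (T (j + 1)).1 := by
      rw [← hyT (j + 1 + d), mul_assoc, hdec' (j + 1) d]
    have h3 : star (y j) * (T (j + 1)).1 = 0 := by
      simpa [hstar] using congrArg star (hyT1 j).2
    have h4 : star (y (j + 1 + d)) = (T (j + 1)).1 * star (y (j + 1 + d)) := by
      simpa [hstar] using congrArg star h2
    refine ⟨?_, ?_, ?_, ?_⟩
    · rw [h1, ← mul_assoc, (hyT1 j).1, zero_mul]
    · rw [h2, mul_assoc, (hyT1 j).2, mul_zero]
    · rw [h1, ← mul_assoc, h3, zero_mul]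
    · rw [h4, ← mul_assoc, (hyT1 j).1, zero_mul]
  obtain ⟨X, hXX, hXl, hXr, hXc, hXc', hXP, hXP'⟩ := exists_sum_of_orthogonal (y := y)
    (fun j k => by
      rcases lt_trichotomy j k with h | h | h
      · exact (horth j k h).1
      · rw [h, hyy]
      · exact (horth k j h).2.1)
    (fun j k hjk => by
      rcases lt_or_gt_of_ne hjk with h | h
      · exact (horth j k h).2.2.1
      · simpa using congrArg star (horth k j h).2.2.1)
    (fun j k hjk => by
      rcases lt_or_gt_of_ne hjk with h | h
      · exact (horth j k h).2.2.2
      · simpa using congrArg star (horth k j h).2.2.2)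
  obtain ⟨R, hR⟩ := hA X
  have hb0 := CFC.sqrt_nonneg (star X * X)
  have hbs := hb0.isSelfAdjoint.star_eq
  have hbb : CFC.sqrt (star X * X) * CFC.sqrt (star X * X) = star X * X :=
    CFC.sqrt_mul_sqrt_self _ (star_mul_self_nonneg X)
  obtain ⟨W, hW⟩ := exists_mul_eq_of_mul_self_eq_zero hA hXX hb0 hbb
  obtain ⟨v, hv, -, hS, -, -⟩ := exists_partialIsometry_of_mul_eq hbs hbb
    (hR.of_star_mul_self_eq (by rw [hbs, hbb])) hW
  obtain ⟨hSR, hRS, hXS, hRX⟩ := hS.mul_eq_zero_of_mul_self hR hXX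
  have hPy : ∀ k, P * y k = y k := fun k => by
    have := hdec 0 k
    rw [zero_add] at this
    rw [← hTy, ← mul_assoc]
    exact congrArg (· * y k) this
  have hyP : ∀ k, y k * P = y k := fun k => by
    have := hdec' 0 k
    rw [zero_add] at this
    rw [← hyT, mul_assoc]
    exact congrArg (y k * ·) this
  have hPX := hXP P hPy
  have hXP := hXP' P hyP
  have hPR := hR.mul_eq_self hP hXP
  have hPS := hS.mul_eq_self hP hPX
  have hvR : v * R = v := mul_projection_eq_self_of_star_mul_self hR.1 (by rw [hv, hR.1.2])
  have comm : ∀ (c : A) (k l : ℕ), p l * c = c → c * p l = c → Commute (p k) c := by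
    intro c k l h1 h2
    by_cases h : k = l
    · subst h; rw [commute_iff_eq, h1, h2]
    · rw [commute_iff_eq, ← h1, ← mul_assoc, hpp k l h, zero_mul, h1, ← h2, mul_assoc,
        hpp l k (Ne.symm h), mul_zero]
  have hRp : ∀ n, Commute (p n) R := fun n =>
    hR.commute_of_commute_star_mul_self (hXc _ fun k => comm _ _ (Nat.unpair k).2 (by
      have := congrArg star (hyp k).1
      rw [star_mul, (hp _).1] at this
      rw [← mul_assoc, this]) (by rw [mul_assoc, (hyp k).1]))
  have hSp : ∀ n, Commute (p n) (v * star v) := fun n =>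
    hS.commute_of_commute_mul_star_self (hXc' _ fun k => comm _ _ (Nat.unpair k).1
      (by rw [← mul_assoc, (hyp k).2]) (by
      have := congrArg star (hyp k).2
      rw [star_mul, (hp _).1] at this
      rw [mul_assoc, this]))
  have ht : IsProjection (P - (v * star v + R)) :=
    hP.sub_of_mul_eq (hR.1.add_of_mul_eq_zero hS.1 hSR) (by rw [mul_add, hPS, hPR])
  have htp : ∀ n, Commute (P - (v * star v + R)) (p n) := fun n =>
    (hPp n).sub_left ((hSp n).symm.add_left (hRp n).symm)
  have htX : (P - (v * star v + R)) * X = 0 := by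
    rw [sub_mul, hPX, add_mul, hS.2.1, hRX, add_zero, sub_self]
  have hXt : X * (P - (v * star v + R)) = 0 := by
    rw [mul_sub, hXP, mul_add, hXS, hR.2.1, zero_add, sub_self]
  have htP : (P - (v * star v + R)) * P = P - (v * star v + R) := by
    have h1 : R * P = R := by simpa [hP.1, hR.1.1] using congrArg star hPR
    have h2 : v * star v * P = v * star v := by simpa [hP.1] using congrArg star hPS
    rw [sub_mul, add_mul, h1, h2, hP.2]
  have hsum : (P - (v * star v + R)) + v * star v + R = P := by abel
  have hvv : v * star v * v = v := by rw [mul_assoc, hv, hvR]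
  refine ⟨R, v, P - (v * star v + R), hR.1, hS.1, ht, hv, ?_, hPR, ?_, hsum,
    fun n => (hRp n).symm, fun n => (hSp n).symm, htp, ?_⟩
  · rw [← hvv, ← mul_assoc, hRS, zero_mul]
  · rw [← hvv, ← mul_assoc, hPS]
  generalize P - (v * star v + R) = t at *
  have hty := hXl t htX
  have hyt := hXr t hXt
  have htT : ∀ k, t * (T k).1 = t := fun k => by
    induction k with
    | zero => exact htP
    | succ k ih =>
      by_cases h : (Nat.unpair k).1 = (Nat.unpair k).2
      · rw [hT1, hF3 k (T k) h, ih]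
      · have h1 := hty k
        have h2 := hyt k
        simp only [y, if_pos h] at h1 h2
        exact (hF2 k (T k) h).2.2 t ht ih h1 h2
  intro m n hmn
  have h1 := hty (Nat.pair m n)
  have h2 := htT (Nat.pair m n)
  have h3 : (T (Nat.pair m n)).1 * t = t := by
    simpa [ht.1, hstar] using congrArg star h2
  simp only [y, Nat.unpair_pair, if_pos hmn] at h1
  calc t * p m * w n * p n * t = t * (T (Nat.pair m n)).1 * p m * w n * p n *
        ((T (Nat.pair m n)).1 * t) := by rw [h2, h3]
    _ = t * ((T (Nat.pair m n)).1 * p m * w n * p n * (T (Nat.pair m n)).1) * t := by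
      simp only [mul_assoc]
    _ = 0 := by rw [h1, zero_mul]

end Exhaustion

section OrthogonalSequences

variable {A : Type*} [NonUnitalCStarAlgebra A]

/-- A sequence of partial isometries `w n` with orthogonal final projections and with orthogonal
initial projections `p n`, of supremum `P` in the sense of annihilators. -/
structure IsOrthogonalPolarSequence (p w : ℕ → A) (P : A) : Prop where
  isProjection : ∀ n, IsProjection (p n)
  orthogonal : ∀ m n, m ≠ n → p m * p n = 0
  mul_eq : ∀ n, w n * p n = w n
  star_mul_self : ∀ n, star (w n) * w n = p n
  star_mul_of_ne : ∀ m n, m ≠ n → star (w m) * w n = 0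
  isProjection_sup : IsProjection P
  sup_mul : ∀ n, P * p n = p n
  sup_mul_eq_zero : ∀ y, (∀ n, p n * y = 0) → P * y = 0

theorem IsOrthogonalPolarSequence.commute_sup {p w : ℕ → A} {P : A}
    (h : IsOrthogonalPolarSequence p w P) (n : ℕ) : Commute P (p n) := by
  have : p n * P = p n := by
    simpa [h.isProjection_sup.1, (h.isProjection n).1] using congrArg star (h.sup_mul n)
  rw [commute_iff_eq, h.sup_mul, this]

/-- Each corner of an orthogonal sequence is encoded by a single element `x` with absolute
value `b`. -/
theorem IsOrthogonalPolarSequence.exists_weighted_sum [PartialOrder A] [StarOrderedRing A]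
    {p w : ℕ → A} {P d : A} (h : IsOrthogonalPolarSequence p w P) (hd : IsProjection d)
    (hPd : P * d = d) (hdp : ∀ n, Commute d (p n)) :
    ∃ x b : A, 0 ≤ b ∧ b * b = star x * x ∧ IsARP b d ∧
      (∀ y, y * b = x → ∀ n, y * p n * d = w n * d) ∧
      ((∀ m n, m ≠ n → d * p m * w n * p n * d = 0) → Commute (d * x) b) := by
  let a : ℕ → ℝ := fun k => (1 / 2) ^ k
  have ha : ∀ k, 0 < a k := fun k => by positivity
  have hnorm : ∀ k, ∀ c : A, ‖c‖ ≤ 1 → ‖a k • (c * d)‖ ≤ (1 / 2 : ℝ) ^ k := fun k c hc => by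
    rw [norm_smul, Real.norm_of_nonneg (ha k).le]
    refine mul_le_of_le_one_right (ha k).le ((norm_mul_le _ _).trans ?_)
    exact mul_le_one₀ hc (norm_nonneg _) hd.norm_le_one
  have hwn : ∀ k, ‖w k‖ ≤ 1 := fun k => by
    have h1 := CStarRing.norm_star_mul_self (x := w k)
    rw [h.star_mul_self] at h1
    have h2 := (h.isProjection k).norm_le_one
    nlinarith [norm_nonneg (w k)]
  have hsx : Summable fun k => a k • (w k * d) :=
    Summable.of_norm_bounded summable_geometric_two fun k => hnorm k _ (hwn k)
  have hsb : Summable fun k => a k • (p k * d) :=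
    Summable.of_norm_bounded summable_geometric_two fun k =>
      hnorm k _ (h.isProjection k).norm_le_one
  have hpd : ∀ n, p n * d = d * p n := fun n => (hdp n).eq.symm
  let x := ∑' k, a k • (w k * d)
  let b := ∑' k, a k • (p k * d)
  have hxr : ∀ c, x * c = ∑' k, a k • (w k * d * c) := fun c => by
    exact (hsx.tsum_mul_right c).symm.trans (tsum_congr fun k => by rw [smul_mul_assoc])
  have hxl : ∀ c, c * x = ∑' k, a k • (c * (w k * d)) := fun c => by
    exact (hsx.tsum_mul_left c).symm.trans (tsum_congr fun k => by rw [mul_smul_comm])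
  have hbr : ∀ c, b * c = ∑' k, a k • (p k * d * c) := fun c => by
    exact (hsb.tsum_mul_right c).symm.trans (tsum_congr fun k => by rw [smul_mul_assoc])
  have hbl : ∀ c, c * b = ∑' k, a k • (c * (p k * d)) := fun c => by
    exact (hsb.tsum_mul_left c).symm.trans (tsum_congr fun k => by rw [mul_smul_comm])
  have hbd : b * d = b := by
    rw [hbr]; simp only [mul_assoc, hd.2]; rfl
  have hxd : x * d = x := by
    rw [hxr]; simp only [mul_assoc, hd.2]; rfl
  have hbp : ∀ n, b * p n = a n • (p n * d) := fun n => by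
    rw [hbr, tsum_eq_single n fun k hk => by
      rw [mul_assoc, (hdp n).eq, ← mul_assoc, h.orthogonal k n hk, zero_mul, smul_zero],
      mul_assoc, (hdp n).eq, ← mul_assoc, (h.isProjection n).2]
  have hpb : ∀ n, p n * b = a n • (p n * d) := fun n => by
    rw [hbl, tsum_eq_single n fun k hk => by
      rw [← mul_assoc, h.orthogonal n k hk.symm, zero_mul, smul_zero],
      ← mul_assoc, (h.isProjection n).2]
  have hxp : ∀ n, x * p n = a n • (w n * d) := fun n => by
    rw [hxr, tsum_eq_single n fun k hk => by
      rw [mul_assoc, (hdp n).eq, ← h.mul_eq k, mul_assoc, ← mul_assoc (p k),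
        h.orthogonal k n hk, zero_mul, mul_zero, smul_zero],
      mul_assoc, (hdp n).eq, ← mul_assoc, h.mul_eq]
  have hwx : ∀ n, star (w n) * x = a n • (p n * d) := fun n => by
    rw [hxl, tsum_eq_single n fun k hk => by
      rw [← mul_assoc, h.star_mul_of_ne n k hk.symm, zero_mul, smul_zero],
      ← mul_assoc, h.star_mul_self]
  have hxw : ∀ n, star x * w n = a n • (p n * d) := fun n => by
    have := congrArg star (hwx n)
    rw [star_mul, star_star, star_smul, star_mul, hd.1, (h.isProjection n).1, ← hpd] at this
    simpa using this
  have hpdd : ∀ n, 0 ≤ p n * d := fun n => by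
    have := star_mul_self_nonneg (p n * d)
    rwa [star_mul, hd.1, (h.isProjection n).1, mul_assoc, ← mul_assoc (p n),
      (h.isProjection n).2, hpd, ← mul_assoc, hd.2, ← hpd] at this
  have hb0 : 0 ≤ b := tsum_nonneg fun k => smul_nonneg (ha k).le (hpdd k)
  refine ⟨x, b, hb0, ?_, ⟨hd, hbd, fun y hy => ?_⟩, fun y hy n => ?_, fun hc => ?_⟩
  · rw [hbl, hxl]
    refine tsum_congr fun k => ?_
    rw [← mul_assoc, ← mul_assoc, hbp, hxw]
  · rw [← hPd, mul_assoc]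
    refine h.sup_mul_eq_zero _ fun n => ?_
    have h1 : (a n • (p n * d)) * y = 0 := by rw [← hpb, mul_assoc, hy, mul_zero]
    rwa [smul_mul_assoc, smul_eq_zero_iff_right (ha n).ne', mul_assoc] at h1
  · have h1 := congrArg (· * p n) hy
    simp only [mul_assoc, hbp, hxp, mul_smul_comm] at h1
    rw [mul_assoc]
    exact smul_right_injective A (ha n).ne' h1
  · have hdw : ∀ n, p n * (d * (w n * d)) = d * (w n * d) := fun n => by
      have h1 : P * (d * (w n * d) - p n * (d * (w n * d))) = 0 := by
        refine h.sup_mul_eq_zero _ fun k => ?_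
        by_cases hk : k = n
        · rw [hk, mul_sub, ← mul_assoc (p n) (p n), (h.isProjection n).2, sub_self]
        · have := hc k n hk
          rw [mul_assoc _ (w n), h.mul_eq] at this
          rw [mul_sub, ← mul_assoc (p k) (p n), h.orthogonal k n hk, zero_mul, sub_zero,
            ← mul_assoc, ← (hdp k).eq, ← mul_assoc]
          exact this
      rw [mul_sub, ← mul_assoc P d, hPd, ← mul_assoc P (p n), h.sup_mul, sub_eq_zero] at h1
      exact h1.symm
    have h1 : ∀ n, Commute (d * x) (p n) := fun n => by
      have h2 : p n * (d * x) = a n • (p n * (d * (w n * d))) := by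
        rw [← mul_assoc, hxl, tsum_eq_single n fun k hk => ?_, mul_assoc]
        have := hc n k (Ne.symm hk)
        rw [mul_assoc _ (w k), h.mul_eq, (hdp n).eq] at this
        rw [← mul_assoc, this, smul_zero]
      rw [commute_iff_eq, h2, hdw, mul_assoc, hxp, mul_smul_comm]
    have h2 : Commute (d * x) d := by
      rw [commute_iff_eq, mul_assoc, hxd, ← mul_assoc, hd.2]
    exact Commute.tsum_right _ fun k => ((h1 k).mul_right h2).smul_right _

theorem exists_mul_eq_of_sum_eq {p w : ℕ → A} {S d₁ d₂ d₃ : A} (hS : d₁ + d₂ + d₃ = S)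
    (h₁ : d₁ * S = d₁) (h₂ : d₂ * S = d₂) (h₃ : d₃ * S = d₃) (hc₁ : ∀ n, Commute d₁ (p n))
    (hc₂ : ∀ n, Commute d₂ (p n)) (hc₃ : ∀ n, Commute d₃ (p n))
    (hy₁ : ∃ y, ∀ n, y * p n * d₁ = w n * d₁) (hy₂ : ∃ y, ∀ n, y * p n * d₂ = w n * d₂)
    (hy₃ : ∃ y, ∀ n, y * p n * d₃ = w n * d₃) : ∃ y, ∀ n, y * p n * S = w n * S := by
  obtain ⟨y₁, hy₁⟩ := hy₁
  obtain ⟨y₂, hy₂⟩ := hy₂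
  obtain ⟨y₃, hy₃⟩ := hy₃
  have key : ∀ {d y : A} (n : ℕ), d * S = d → Commute d (p n) → y * p n * d = w n * d →
      y * d * p n * S = w n * d := by
    intro d y n h hc hy
    rw [mul_assoc y, hc.eq, ← mul_assoc, mul_assoc _ d, h, hy]
  refine ⟨y₁ * d₁ + y₂ * d₂ + y₃ * d₃, fun n => ?_⟩
  rw [add_mul, add_mul, add_mul, add_mul, key n h₁ (hc₁ n) (hy₁ n), key n h₂ (hc₂ n) (hy₂ n),
    key n h₃ (hc₃ n) (hy₃ n), ← mul_add, ← mul_add, hS]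

variable [PartialOrder A] [StarOrderedRing A]

theorem IsOrthogonalPolarSequence.exists_mul_eq_of_offDiagonal_eq_zero (hA : WeaklyRickart A)
    {p w : ℕ → A} {P d : A} (h : IsOrthogonalPolarSequence p w P) (hd : IsProjection d)
    (hPd : P * d = d) (hdp : ∀ n, Commute d (p n))
    (hw : ∀ m n, m ≠ n → d * p m * w n * p n * d = 0) :
    ∃ y, ∀ n, y * p n * d = w n * d := by
  obtain ⟨x, b, hb, hbx, hbd, hy, hc⟩ := h.exists_weighted_sum hd hPd hdp
  obtain ⟨y, hyx⟩ := exists_mul_eq_of_commute_projection_mul hA hb hbx hbd (hc hw)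
  exact ⟨y, hy y hyx⟩

theorem IsOrthogonalPolarSequence.exists_mul_eq_of_two_copies (hA : WeaklyRickart A)
    {p w : ℕ → A} {P d V₁ V₂ : A} (h : IsOrthogonalPolarSequence p w P) (hd : IsProjection d)
    (hPd : P * d = d) (hdp : ∀ n, Commute d (p n)) (hV₁ : star V₁ * V₁ = d)
    (hV₂ : star V₂ * V₂ = d) (hdV₁ : d * V₁ = 0) (hdV₂ : d * V₂ = 0) (hV : star V₁ * V₂ = 0) :
    ∃ y, ∀ n, y * p n * d = w n * d := by
  obtain ⟨x, b, hb, hbx, hbd, hy, -⟩ := h.exists_weighted_sum hd hPd hdp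
  obtain ⟨y, hyx⟩ := exists_mul_eq_of_two_orthogonal_copies hA hb hbx hbd hV₁ hV₂ hdV₁ hdV₂ hV
  exact ⟨y, hy y hyx⟩

theorem IsOrthogonalPolarSequence.exists_mul_eq_of_copy (hA : WeaklyRickart A)
    {p w : ℕ → A} {P S V : A} (h : IsOrthogonalPolarSequence p w P) (hS : IsProjection S)
    (hPS : P * S = S) (hSp : ∀ n, Commute S (p n)) (hV : star V * V = S) (hSV : S * V = 0) :
    ∃ y, ∀ n, y * p n * S = w n * S := by
  obtain ⟨R, v, t, hR, hQ, ht, hvR, hRv, hSR, hSv, hsum, hRp, hQp, htp, hoff⟩ :=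
    exists_equivalent_projections (w := w) hA h.isProjection h.orthogonal hS hSp
  have hRS : R * S = R := by simpa [hR.1, hS.1] using congrArg star hSR
  have hvS : star v * S = star v := by simpa [hS.1] using congrArg star hSv
  have hvR' : v * R = v := mul_projection_eq_self_of_star_mul_self hR (by rw [hvR, hR.2])
  have hSQ : S * (v * star v) = v * star v := by rw [← mul_assoc, hSv]
  have hQS : v * star v * S = v * star v := by rw [mul_assoc, hvS]
  have htS : t * S = t := by
    rw [← eq_sub_iff_add_eq, ← eq_sub_iff_add_eq] at hsum
    rw [hsum, sub_mul, sub_mul, hS.2, hRS, hQS]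
  have hSt : S * t = t := by simpa [ht.1, hS.1] using congrArg star htS
  have hle : ∀ {d}, S * d = d → P * d = d := fun {d} hd => by
    rw [← hd, ← mul_assoc, hPS]
  have hvv : v * v = 0 := by rw [← hvR', mul_assoc, hvR', hRv, mul_zero]
  have hvv' : star v * star v = 0 := by rw [← star_mul, hvv, star_zero]
  refine exists_mul_eq_of_sum_eq hsum htS hQS hRS htp hQp hRp ?_ ?_ ?_
  · exact h.exists_mul_eq_of_offDiagonal_eq_zero hA ht (hle hSt) htp hoff
  · refine h.exists_mul_eq_of_two_copies (V₁ := star v) (V₂ := V * (v * star v)) hA hQ (hle hSQ)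
      hQp ?_ ?_ ?_ ?_ ?_
    · rw [star_star]
    · rw [star_mul, hQ.1, mul_assoc, ← mul_assoc (star V), hV, hSQ, hQ.2]
    · rw [mul_assoc, hvv', mul_zero]
    · rw [← mul_assoc, ← hQS, mul_assoc _ S, hSV, mul_zero, zero_mul]
    · have hvV : v * V = 0 := by
        calc v * V = v * R * S * V := by rw [mul_assoc v, hRS, hvR']
          _ = 0 := by rw [mul_assoc, hSV, mul_zero]
      rw [star_star, ← mul_assoc, hvV, zero_mul]
  · refine h.exists_mul_eq_of_two_copies (V₁ := v) (V₂ := V * R) hA hR (hle hSR)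
      hRp hvR ?_ hRv ?_ ?_
    · rw [star_mul, hR.1, mul_assoc, ← mul_assoc (star V), hV, hSR, hR.2]
    · rw [← mul_assoc, ← hRS, mul_assoc _ S, hSV, mul_zero, zero_mul]
    · rw [← mul_assoc, ← hvS, mul_assoc _ S, hSV, mul_zero, zero_mul]

/-- An orthogonal sequence of partial isometries has a supremum. -/
theorem IsOrthogonalPolarSequence.exists_mul_eq (hA : WeaklyRickart A) {p w : ℕ → A} {P : A}
    (h : IsOrthogonalPolarSequence p w P) : ∃ y, ∀ n, y * p n = w n := by
  obtain ⟨R, v, t, hR, hQ, ht, hvR, hRv, hPR, hPv, hsum, hRp, hQp, htp, hoff⟩ :=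
    exists_equivalent_projections (w := w) hA h.isProjection h.orthogonal h.isProjection_sup
      h.commute_sup
  have hP := h.isProjection_sup
  have hRP : R * P = R := by simpa [hR.1, hP.1] using congrArg star hPR
  have hvP : star v * P = star v := by simpa [hP.1] using congrArg star hPv
  have hvR' : v * R = v := mul_projection_eq_self_of_star_mul_self hR (by rw [hvR, hR.2])
  have hPQ : P * (v * star v) = v * star v := by rw [← mul_assoc, hPv]
  have hQP : v * star v * P = v * star v := by rw [mul_assoc, hvP]
  have htP : t * P = t := by
    rw [← eq_sub_iff_add_eq, ← eq_sub_iff_add_eq] at hsum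
    rw [hsum, sub_mul, sub_mul, hP.2, hRP, hQP]
  have hPt : P * t = t := by simpa [ht.1, hP.1] using congrArg star htP
  have hvv : v * v = 0 := by rw [← hvR', mul_assoc, hvR', hRv, mul_zero]
  have hvv' : star v * star v = 0 := by rw [← star_mul, hvv, star_zero]
  obtain ⟨y, hy⟩ := exists_mul_eq_of_sum_eq hsum htP hQP hRP htp hQp hRp
    (h.exists_mul_eq_of_offDiagonal_eq_zero hA ht hPt htp hoff)
    (h.exists_mul_eq_of_copy (V := star v) hA hQ hPQ hQp (by rw [star_star])
      (by rw [mul_assoc, hvv', mul_zero]))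
    (h.exists_mul_eq_of_copy hA hR hPR hRp hvR hRv)
  refine ⟨y, fun n => ?_⟩
  have hpP : p n * P = p n := by rw [← (h.commute_sup n).eq, h.sup_mul]
  have hwP : w n * P = w n := by
    calc w n * P = w n * p n * P := by rw [h.mul_eq]
      _ = w n := by rw [mul_assoc, hpP, h.mul_eq]
  rw [← hwP, ← hy n, mul_assoc, hpP]

end OrthogonalSequences

section PolarDecomposition

variable {A : Type*} [NonUnitalCStarAlgebra A] [PartialOrder A] [StarOrderedRing A]

theorem exists_dyadic_cutoffs {b : A} (hb : 0 ≤ b) :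
    ∃ f K r : ℕ → A, (∀ n, IsSelfAdjoint (f n)) ∧ (∀ n, Commute b (f n)) ∧
      (∀ n, IsSelfAdjoint (K n)) ∧ (∀ n, Commute b (K n)) ∧ (∀ m n, Commute (K m) (f n)) ∧
      (∀ n, K n * b * f n = f n) ∧ (∀ n, r n * f (n + 1) = f n) ∧
      (∀ n, ∃ c, c * b = f n) ∧ ∀ n, ‖b - f n‖ ≤ (1 / 2 : ℝ) ^ n := by
  have hε : ∀ n : ℕ, 0 < (1 / 2 : ℝ) ^ n := fun n => by positivity
  let F : ℕ → ℝ → ℝ := fun n t => max (t - (1 / 2) ^ n) 0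
  let G : ℕ → ℝ → ℝ := fun n t => t / max t ((1 / 2) ^ n) ^ 2
  let R : ℕ → ℝ → ℝ := fun n t => F n t / max (F (n + 1) t) ((1 / 2) ^ (n + 1))
  have hmax : ∀ (n : ℕ) (t : ℝ), 0 < max t ((1 / 2) ^ n) := fun n t => lt_max_of_lt_right (hε n)
  have hFc : ∀ n, Continuous (F n) := fun n => by fun_prop
  have hGc : ∀ n, Continuous (G n) := fun n =>
    continuous_id.div (by fun_prop) fun t => (pow_pos (hmax n t) 2).ne'
  have hRc : ∀ n, Continuous (R n) := fun n =>
    (hFc n).div (by fun_prop) fun t => (hmax _ _).ne'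
  have hF0 : ∀ n, F n 0 = 0 := fun n => by simp [F]
  have hG0 : ∀ n, G n 0 = 0 := fun n => by simp [G]
  have hR0 : ∀ n, R n 0 = 0 := fun n => by simp [R, hF0]
  have hσ : ∀ t ∈ quasispectrum ℝ b, 0 ≤ t := quasispectrum_nonneg_of_nonneg b hb
  have hbid : cfcₙ (fun t : ℝ => t) b = b := cfcₙ_id' ℝ b
  have hmul : ∀ {f g : ℝ → ℝ}, Continuous f → Continuous g → f 0 = 0 → g 0 = 0 →
      cfcₙ f b * cfcₙ g b = cfcₙ (fun t => f t * g t) b := fun hf hg hf0 hg0 =>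
    (cfcₙ_mul _ _ b hf.continuousOn hf0 hg.continuousOn hg0).symm
  have hcb : ∀ f : ℝ → ℝ, Commute b (cfcₙ f b) := fun f => by
    have := cfcₙ_commute_cfcₙ (fun t : ℝ => t) f b
    rwa [hbid] at this
  have hGt : ∀ n t, 0 < F n t → G n t * t = 1 := fun n t ht => by
    have h1 : (1 / 2 : ℝ) ^ n < t := by
      by_contra! h
      simp only [F] at ht
      rw [max_eq_right (by linarith)] at ht
      exact lt_irrefl _ ht
    have h2 : 0 < t := (hε n).trans h1
    simp only [G]
    rw [max_eq_left h1.le]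
    field_simp
  have hFnn : ∀ n t, 0 ≤ F n t := fun n t => le_max_right _ _
  refine ⟨fun n => cfcₙ (F n) b, fun n => cfcₙ (G n) b, fun n => cfcₙ (R n) b,
    fun n => cfcₙ_predicate _ b, fun n => hcb _, fun n => cfcₙ_predicate _ b, fun n => hcb _,
    fun m n => cfcₙ_commute_cfcₙ _ _ b, fun n => ?_, fun n => ?_, fun n => ?_, fun n => ?_⟩
  · have h1 : cfcₙ (G n) b * b = cfcₙ (fun t => G n t * t) b := by
      nth_rewrite 2 [← hbid]
      exact hmul (hGc n) continuous_id' (hG0 n) rfl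
    rw [h1, hmul (f := fun t => G n t * t) ((hGc n).mul continuous_id') (hFc n) (by simp) (hF0 n)]
    refine cfcₙ_congr fun t _ => ?_
    rcases (hFnn n t).eq_or_lt with h | h
    · simp [← h]
    · simp [hGt n t h]
  · rw [hmul (hRc n) (hFc _) (hR0 n) (hF0 _)]
    refine cfcₙ_congr fun t _ => ?_
    simp only [R]
    have hpow : (1 / 2 : ℝ) ^ n = (1 / 2) ^ (n + 1) + (1 / 2) ^ (n + 1) := by ring
    rcases le_or_gt t ((1 / 2) ^ n) with h | h
    · have : F n t = 0 := max_eq_right (by linarith)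
      simp [this]
    · have h1 : F (n + 1) t = t - (1 / 2) ^ (n + 1) :=
        max_eq_left (by linarith [hε (n + 1)])
      have h2 : (1 / 2) ^ (n + 1) ≤ F (n + 1) t := by rw [h1]; linarith
      rw [max_eq_left h2, div_mul_cancel₀]
      exact ((hε _).trans_le h2).ne'
  · let C : ℝ → ℝ := fun t => F n t / max t ((1 / 2) ^ n)
    have hCc : Continuous C := (hFc n).div (by fun_prop) fun t => (hmax n t).ne'
    have hC0 : C 0 = 0 := by simp [C, hF0]
    refine ⟨cfcₙ C b, ?_⟩
    nth_rewrite 2 [← hbid]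
    rw [hmul hCc continuous_id' hC0 rfl]
    refine cfcₙ_congr fun t _ => ?_
    simp only [C]
    rcases le_or_gt t ((1 / 2) ^ n) with h | h
    · have : F n t = 0 := max_eq_right (by linarith)
      simp [this]
    · rw [max_eq_left h.le, div_mul_cancel₀]
      exact ((hε n).trans h).ne'
  · have h1 : b - cfcₙ (F n) b = cfcₙ (fun t => t - F n t) b := by
      rw [cfcₙ_sub _ _ b (by fun_prop) rfl (hFc n).continuousOn (hF0 n), hbid]
    rw [h1]
    refine norm_cfcₙ_le fun t ht => ?_
    have h0 := hσ t ht
    rw [Real.norm_eq_abs, abs_le]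
    simp only [F]
    have := hε n
    rcases le_total (t - (1 / 2) ^ n) 0 with h | h
    · rw [max_eq_right h]; constructor <;> linarith
    · rw [max_eq_left h]; constructor <;> linarith

theorem exists_mul_eq_of_mul_self_eq (hA : WeaklyRickart A) {x b : A} (hb : 0 ≤ b)
    (hbx : b * b = star x * x) : ∃ y, y * b = x := by
  obtain ⟨f, K, r, hf, hbf, hK, hbK, hKf, hKf', hrf, hcf, hbn⟩ := exists_dyadic_cutoffs hb
  have hb' : star b = b := hb.isSelfAdjoint.star_eq
  choose e he using fun n => hA (f n)
  obtain ⟨P, hP⟩ := hA x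
  have hPb : IsARP b P := hP.of_star_mul_self_eq (by rw [hb', hbx])
  let q : ℕ → A := fun n => Nat.casesOn n 0 e
  have hq0 : q 0 = 0 := rfl
  have hq1 : ∀ n, q (n + 1) = e n := fun n => rfl
  have hqproj : ∀ n, IsProjection (q n) := fun n => by
    cases n with
    | zero => exact ⟨star_zero A, mul_zero 0⟩
    | succ n => exact (he n).1
  have hqq : ∀ n, q (n + 1) * q n = q n := fun n => by
    cases n with
    | zero => rw [hq0, mul_zero]
    | succ n =>
      refine (he n).mul_eq_self (he (n + 1)).1 ?_
      rw [← hrf, mul_assoc, (he (n + 1)).2.1]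
  have hqle : ∀ m n, m ≤ n → q n * q m = q m := fun m n hmn => by
    induction n, hmn using Nat.le_induction with
    | base => exact (hqproj m).2
    | succ n hmn ih => rw [← ih, ← mul_assoc, hqq]
  have hqle' : ∀ m n, m ≤ n → q m * q n = q m := fun m n hmn => by
    simpa [(hqproj m).1, (hqproj n).1] using congrArg star (hqle m n hmn)
  have hPq : ∀ n, P * q n = q n := fun n => by
    cases n with
    | zero => rw [hq0, mul_zero]
    | succ n =>
      refine (he n).mul_eq_self hP.1 ?_
      obtain ⟨c, hc⟩ := hcf n
      rw [← hc, mul_assoc, hPb.2.1]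
  have hbq : ∀ n, Commute b (q n) := fun n => by
    cases n with
    | zero => exact Commute.zero_right b
    | succ n => exact (he n).commute (hf n) (hbf n)
  have hKq : ∀ n, K n * b * q (n + 1) = q (n + 1) := fun n => by
    have h1 : (K n * b * q (n + 1) - q (n + 1)) * f n = 0 := by
      rw [sub_mul, mul_assoc _ (q (n + 1)), hq1, (he n).mul_left_of_isSelfAdjoint (hf n), hKf',
        sub_self]
    have h2 := (he n).mul_right_eq_zero (hf n) h1
    rwa [sub_mul, mul_assoc _ (q (n + 1)), hq1, (he n).1.2, sub_eq_zero] at h2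
  have hKcq : ∀ m n, Commute (K m) (q n) := fun m n => by
    cases n with
    | zero => exact Commute.zero_right _
    | succ n => exact (he n).commute (hf n) (hKf m n)
  let p : ℕ → A := fun n => q (n + 1) - q n
  have hp : ∀ n, IsProjection (p n) := fun n => (hqproj (n + 1)).sub_of_mul_eq (hqproj n) (hqq n)
  have hqp : ∀ n, q (n + 1) * p n = p n := fun n => by
    simp only [p, mul_sub, (hqproj _).2, hqq]
  have hpq0 : ∀ m n, m < n → p m * p n = 0 := fun m n hmn => by
    simp only [p, sub_mul, mul_sub, hqle' (m + 1) (n + 1) (by omega), hqle' (m + 1) n (by omega),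
      hqle' m (n + 1) (by omega), hqle' m n (by omega), sub_self]
  have hpp : ∀ m n, m ≠ n → p m * p n = 0 := fun m n hmn => by
    rcases lt_or_gt_of_ne hmn with h | h
    · exact hpq0 m n h
    · simpa [(hp m).1, (hp n).1] using congrArg star (hpq0 n m h)
  have hbp : ∀ n, Commute b (p n) := fun n => (hbq (n + 1)).sub_right (hbq n)
  have hKp : ∀ m n, Commute (K m) (p n) := fun m n => (hKcq m (n + 1)).sub_right (hKcq m n)
  have hKbp : ∀ n, K n * b * p n = p n := fun n => by
    rw [← hqp, ← mul_assoc, hKq]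
  have hPp : ∀ n, P * p n = p n := fun n => by
    simp only [p, mul_sub, hPq]
  have hww : ∀ m n, star (x * K m * p m) * (x * K n * p n) = p m * (K m * b) * (K n * b * p n) := by
    intro m n
    rw [star_mul, star_mul, (hp m).1, (hK m).star_eq, ← (hbK n).eq]
    simp only [mul_assoc]
    rw [← mul_assoc (star x) x, ← hbx, mul_assoc]
  have hpKb : ∀ n, p n * (K n * b) = p n := fun n => by
    rw [← ((hKp n n).mul_left (hbp n)).eq, hKbp]
  have hseq : IsOrthogonalPolarSequence p (fun n => x * K n * p n) P :=
    { isProjection := hp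
      orthogonal := hpp
      mul_eq := fun n => by rw [mul_assoc, (hp n).2]
      star_mul_self := fun n => by rw [hww, hKbp, hpKb, (hp n).2]
      star_mul_of_ne := fun m n hmn => by rw [hww, hKbp, hpKb, hpp m n hmn]
      isProjection_sup := hP.1
      sup_mul := hPp
      sup_mul_eq_zero := fun y hy => by
        have hqy : ∀ n, q n * y = 0 := fun n => by
          induction n with
          | zero => rw [hq0, zero_mul]
          | succ n ih =>
            have := hy n
            rwa [sub_mul, ih, sub_zero] at this
        have hle : ∀ n, ‖b * y‖ ≤ (1 / 2 : ℝ) ^ n * ‖y‖ := fun n => by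
          have hfy : f n * y = 0 := by
            have hey : e n * y = 0 := hqy (n + 1)
            rw [← (he n).2.1, mul_assoc, hey, mul_zero]
          have : b * y = (b - f n) * y := by rw [sub_mul, hfy, sub_zero]
          rw [this]
          exact (norm_mul_le _ _).trans (mul_le_mul_of_nonneg_right (hbn n) (norm_nonneg y))
        have hlim : Filter.Tendsto (fun n : ℕ => (1 / 2 : ℝ) ^ n * ‖y‖) Filter.atTop (nhds 0) := by
          simpa using (tendsto_pow_atTop_nhds_zero_of_lt_one (r := (1 / 2 : ℝ)) (by norm_num)
            (by norm_num)).mul_const ‖y‖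
        exact hPb.2.2 y (norm_le_zero_iff.1 (ge_of_tendsto' hlim hle)) }
  obtain ⟨y, hy⟩ := hseq.exists_mul_eq hA
  refine ⟨y, ?_⟩
  have h1 : ∀ n, (y * b - x) * p n = 0 := fun n => by
    rw [sub_mul, mul_assoc, (hbp n).eq, ← mul_assoc, hy, mul_assoc, ← (hbp n).eq, mul_assoc,
      ← mul_assoc (K n), hKbp, sub_self]
  have h2 : P * star (y * b - x) = 0 := hseq.sup_mul_eq_zero _ fun n => by
    simpa [(hp n).1] using congrArg star (h1 n)
  have h3 := congrArg star h2
  rwa [star_mul, star_star, hP.1.1, star_zero, sub_mul, mul_assoc, hPb.2.1, hP.2.1,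
    sub_eq_zero] at h3

end PolarDecomposition

section PeirceCondition

variable {A : Type*} [NonUnitalCStarAlgebra A]

theorem mul_self_mul_mem_innerIdealGen (x a : A) : x * a * x ∈ innerIdealGen x :=
  subset_closure ⟨a, rfl⟩

theorem innerIdealGen_subset_Peirce2 {x e : A} (hl : e * star e * x = x)
    (hr : x * (star e * e) = x) : innerIdealGen x ⊆ Peirce2 e := by
  refine closure_minimal ?_ ?_
  · rintro _ ⟨a, rfl⟩
    change e * star e * (x * a * x) * (star e * e) = x * a * x
    rw [mul_assoc x a x, ← mul_assoc _ x, hl, mul_assoc, mul_assoc a, hr]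
  · exact isClosed_eq (by fun_prop) continuous_id

theorem mul_star_mul_mem_innerIdealGen (x e : A) {a b : A} (ha : a ∈ innerIdealGen x)
    (hb : b ∈ innerIdealGen x) : a * star e * b ∈ innerIdealGen x := by
  refine map_mem_closure₂ (f := fun a b => a * star e * b) (by fun_prop) ha hb ?_
  rintro _ ⟨c, rfl⟩ _ ⟨d, rfl⟩
  exact ⟨c * x * star e * x * d, by simp only [mul_assoc]⟩

theorem mul_star_mul_mem_innerIdealGen_of_commute {x e : A} (hl : e * star x = x * star e)
    (hr : star x * e = star e * x) {a : A} (ha : a ∈ innerIdealGen x) :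
    e * star a * e ∈ innerIdealGen x := by
  refine map_mem_closure (f := fun a => e * star a * e) (by fun_prop) ha ?_
  rintro _ ⟨c, rfl⟩
  refine ⟨star e * star c * star e, ?_⟩
  calc e * star (x * c * x) * e = e * star x * star c * (star x * e) := by
        simp only [star_mul, mul_assoc]
    _ = x * (star e * star c * star e) * x := by rw [hl, hr]; simp only [mul_assoc]

theorem mem_Peirce0_of_forall_orthog {x e t : A} (hr : IsARP x (star e * e))
    (hl : IsALP x (e * star e)) (ht : ∀ s ∈ innerIdealGen x, Orthog s t) : t ∈ Peirce0 e := by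
  obtain ⟨h1, h2⟩ := ht _ (mul_self_mul_mem_innerIdealGen x (star x))
  have h3 : x * star t = 0 := by
    have : star x * x * (star x * x * star t) = 0 := by
      rw [mul_assoc (star x) x, ← mul_assoc x, ← mul_assoc x, h1, mul_zero]
    have hrr := hr.of_star_mul_self
    have h4 := hrr.2.2 _ this
    rw [← mul_assoc, hrr.mul_left_of_isSelfAdjoint (IsSelfAdjoint.star_mul_self x)] at h4
    rw [← hr.2.1, mul_assoc, hrr.2.2 _ h4, mul_zero]
  have h4 : star t * x = 0 := by
    have hll := hl.star_isARP
    have hll' := hll.of_star_mul_self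
    rw [star_star] at hll'
    have h5 : star t * (x * star x) * (x * star x) = 0 := by
      rw [← mul_assoc _ x, mul_assoc _ (x * star x) x, h2, zero_mul]
    have hsa := IsSelfAdjoint.mul_star_self x
    have h6 := hll'.mul_right_eq_zero hsa h5
    rw [mul_assoc, hll'.2.1] at h6
    have h7 := hll'.mul_right_eq_zero hsa h6
    rw [← hl.2.1, ← mul_assoc, h7, zero_mul]
  constructor
  · simpa using congrArg star (hl.2.2 _ h4)
  · simpa using congrArg star (hr.2.2 _ h3)

end PeirceCondition

/-- A C*-algebra `A` is weakly Rickart if, and only if, for every `x ∈ A` and every inner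
ideal `J ⊆ A` orthogonal to `A(x)`, there exists a partial isometry `e ∈ A` such that
`A(x) ⊆ A₂(e)`, `e* e = RP(x)`, `e e* = LP(x)`, `x` is positive in the C*-algebra
`(A₂(e), •_e, *_e)` (equivalently `x ∈ A₂(e)` and `e* x` is positive in `A`), `A(x)` is
closed under the product `a •_e b = a e* b` and the involution `a ↦ e a* e`, and
`J ⊆ A₀(e)`. -/
theorem weaklyRickart_iff_strengthened_peirce_condition {A : Type*}
    [NonUnitalCStarAlgebra A] [PartialOrder A] [StarOrderedRing A] :
    WeaklyRickart A ↔
      ∀ (x : A) (J : Submodule ℂ A), IsInnerIdeal J →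
        (∀ s ∈ innerIdealGen x, ∀ t ∈ (J : Set A), Orthog s t) →
        ∃ e : A, IsPartialIsometry e ∧
          innerIdealGen x ⊆ Peirce2 e ∧
          IsARP x (star e * e) ∧
          IsALP x (e * star e) ∧
          (x ∈ Peirce2 e ∧ 0 ≤ star e * x) ∧
          (∀ a ∈ innerIdealGen x, ∀ b ∈ innerIdealGen x,
            a * star e * b ∈ innerIdealGen x) ∧
          (∀ a ∈ innerIdealGen x, e * star a * e ∈ innerIdealGen x) ∧
          (J : Set A) ⊆ Peirce0 e := by
  constructor
  · intro hA x J _ hJ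
    set b := CFC.sqrt (star x * x) with hb
    have hb0 : 0 ≤ b := CFC.sqrt_nonneg _
    have hbs : star b = b := hb0.isSelfAdjoint.star_eq
    have hbx : b * b = star x * x := CFC.sqrt_mul_sqrt_self _ (star_mul_self_nonneg x)
    obtain ⟨w, hw⟩ := exists_mul_eq_of_mul_self_eq hA hb0 hbx
    obtain ⟨P, hP⟩ := hA x
    obtain ⟨e, heP, he, hl, hebx, hexb⟩ :=
      exists_partialIsometry_of_mul_eq hbs hbx (hP.of_star_mul_self_eq (by rw [hbs, hbx])) hw
    have hr : IsARP x (star e * e) := heP ▸ hP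
    have hxe : star x * e = b := by simpa [hbs] using congrArg star hexb
    have hex : e * star x = x * star e := by rw [← hebx, star_mul, hbs, mul_assoc]
    refine ⟨e, he, innerIdealGen_subset_Peirce2 hl.2.1 hr.2.1, hr, hl, ⟨?_, hexb ▸ hb0⟩,
      fun a ha c hc => mul_star_mul_mem_innerIdealGen x e ha hc,
      fun a ha => mul_star_mul_mem_innerIdealGen_of_commute hex (hxe.trans hexb.symm) ha,
      fun t ht => mem_Peirce0_of_forall_orthog hr hl fun s hs => hJ s hs t ht⟩
    change e * star e * x * (star e * e) = x
    rw [hl.2.1, hr.2.1]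
  · intro h x
    obtain ⟨e, -, -, he, -⟩ := h x ⊥ (by simp [IsInnerIdeal]) (by simp [Orthog])
    exact ⟨_, he⟩
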